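/- The map FSpec : LT → P_up(ℕ), sending the class of an L_⊗-sentence φ to FSpec(φ) = {n ∈ ℕ : MSO(n) ⊨ φ}, is a well-defined Boolean algebra isomorphism from the Lindenbaum–Tarski algebra LT of T_MSO(Fin) onto the Boolean algebra P_up(ℕ) of ultimately periodic subsets of ℕ, and moreover FSpec(φ + ψ) = FSpec(φ) +̂ FSpec(ψ) for all φ, ψ, where A +̂ B = {a + b : a ∈ A, b ∈ B}. -/

import Mathlib

open FirstOrder FirstOrder.Language

namespace MSO

/-! ### The language `L_⊗` and its semantics -/

/-- The language `L_⊗`: a constant `⊥`, a unary relation `At`,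
and two binary relations: `⊆` (encoded `true`) and `≤ᴱ` (encoded `false`). -/
def Lmso : Language where
  Functions := fun n => match n with | 0 => Unit | _ => Empty
  Relations := fun n => match n with | 1 => Unit | 2 => Bool | _ => Empty

/-- The constant symbol `⊥`. -/
def botC : Lmso.Constants := Unit.unit
/-- The unary relation symbol `At`. -/
def atR : Lmso.Relations 1 := Unit.unit
/-- The binary relation symbol `⊆`. -/
def subR : Lmso.Relations 2 := true
/-- The binary relation symbol `≤ᴱ`. -/
def exleR : Lmso.Relations 2 := false

/-- The interpretation of `⊥` in an `L_⊗`-structure. -/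
def botE (M : Type*) [Lmso.Structure M] : M := Structure.funMap botC ![]
/-- The interpretation of `At` in an `L_⊗`-structure. -/
def atE {M : Type*} [Lmso.Structure M] (a : M) : Prop := Structure.RelMap atR ![a]
/-- The interpretation of `⊆` in an `L_⊗`-structure. -/
def subE {M : Type*} [Lmso.Structure M] (a b : M) : Prop := Structure.RelMap subR ![a, b]
/-- The interpretation of `≤ᴱ` in an `L_⊗`-structure. -/
def exleE {M : Type*} [Lmso.Structure M] (a b : M) : Prop := Structure.RelMap exleR ![a, b]

/-- The monadic second order version `M̃SO(α)` of a linear order `α`, as an `L_⊗`-structure: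
the universe is the powerset of `α`, `⊆` is inclusion, `⊥` is `∅`, `At` holds of singletons,
and `A ≤ᴱ B` iff there are `a ∈ A` and `b ∈ B` with `a < b`. -/
instance msoStructure (α : Type*) [LinearOrder α] : Lmso.Structure (Set α) where
  funMap := fun {n} f _ => match n, f with
    | 0, _ => (∅ : Set α)
  RelMap := fun {n} r v => match n, r with
    | 1, _ => ∃ a : α, v 0 = {a}
    | 2, true => v 0 ⊆ v 1
    | 2, false => ∃ a ∈ v 0, ∃ b ∈ v 1, a < b

/-- `MSO(n)`, the monadic second order version of the `n`-element linear order. -/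
abbrev MSOn (n : ℕ) : Type := Set (Fin n)

/-- The operation `⊗` on `L_⊗`-structures: the universe is the product, `⊆` is componentwise,
`⊥` is the pair of bottoms, `At` holds of the atoms (minimal non-bottom elements) of the
resulting order, and `(A,B) ≤ᴱ (C,D)` iff (`A ≠ ⊥` and `D ≠ ⊥`), or `A ≤ᴱ C`, or `B ≤ᴱ D`. -/
instance tensorStructure (M N : Type*) [Lmso.Structure M] [Lmso.Structure N] :
    Lmso.Structure (M × N) where
  funMap := fun {n} f _ => match n, f with
    | 0, _ => (botE M, botE N)
  RelMap := fun {n} r v => match n, r with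
    | 1, _ => v 0 ≠ (botE M, botE N) ∧
        ∀ q : M × N, subE q.1 (v 0).1 → subE q.2 (v 0).2 →
          q = (botE M, botE N) ∨ q = v 0
    | 2, true => subE (v 0).1 (v 1).1 ∧ subE (v 0).2 (v 1).2
    | 2, false => ((v 0).1 ≠ botE M ∧ (v 1).2 ≠ botE N) ∨
        exleE (v 0).1 (v 1).1 ∨ exleE (v 0).2 (v 1).2

/-! ### Formulas -/

/-- Bounded `L_⊗`-formulas with no free (outer) variables. -/
abbrev BF (n : ℕ) := Lmso.BoundedFormula Empty n

/-- The `i`-th de Bruijn variable as a term. -/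
def tv {n : ℕ} (i : Fin n) : Lmso.Term (Empty ⊕ Fin n) := Term.var (Sum.inr i)
/-- The constant `⊥` as a term. -/
def tb {n : ℕ} : Lmso.Term (Empty ⊕ Fin n) := Constants.term botC

def sub' {n : ℕ} (i j : Fin n) : BF n := subR.boundedFormula₂ (tv i) (tv j)
def exle' {n : ℕ} (i j : Fin n) : BF n := exleR.boundedFormula₂ (tv i) (tv j)
def at' {n : ℕ} (i : Fin n) : BF n := atR.boundedFormula₁ (tv i)
def eq' {n : ℕ} (i j : Fin n) : BF n := Term.bdEqual (tv i) (tv j)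
def isBot' {n : ℕ} (i : Fin n) : BF n := Term.bdEqual (tv i) tb
def botSub' {n : ℕ} (i : Fin n) : BF n := subR.boundedFormula₂ tb (tv i)

/-- Finite conjunction. -/
def bigAnd {n : ℕ} (l : List (BF n)) : BF n := l.foldr (· ⊓ ·) ⊤
/-- Finite disjunction. -/
def bigOr {n : ℕ} (l : List (BF n)) : BF n := l.foldr (· ⊔ ·) ⊥

/-- `k` is the meet of `i` and `j` (with respect to `⊆`). -/
def isMeet {n : ℕ} (k i j : Fin n) : BF n :=
  sub' k i ⊓ sub' k j ⊓
    ∀' ((sub' (Fin.last n) i.castSucc ⊓ sub' (Fin.last n) j.castSucc) ⟹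
      sub' (Fin.last n) k.castSucc)

/-- `k` is the join of `i` and `j` (with respect to `⊆`). -/
def isJoin {n : ℕ} (k i j : Fin n) : BF n :=
  sub' i k ⊓ sub' j k ⊓
    ∀' ((sub' i.castSucc (Fin.last n) ⊓ sub' j.castSucc (Fin.last n)) ⟹
      sub' k.castSucc (Fin.last n))

/-- The meet of `i` and `j` is `⊥`. -/
def meetIsBot {n : ℕ} (i j : Fin n) : BF n :=
  ∀' ((sub' (Fin.last n) i.castSucc ⊓ sub' (Fin.last n) j.castSucc) ⟹ isBot' (Fin.last n))

/-- The join of `i` and `j` is the top element. -/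
def joinIsTop {n : ℕ} (i j : Fin n) : BF n :=
  ∀' ((sub' i.castSucc (Fin.last n) ⊓ sub' j.castSucc (Fin.last n)) ⟹
    ∀' (sub' (Fin.last (n + 1)) ((Fin.last n).castSucc)))

/-- `j` is a (Boolean) complement of `i`. -/
def isComplOf {n : ℕ} (j i : Fin n) : BF n := meetIsBot i j ⊓ joinIsTop i j

/-- `i` is an atom: non-bottom, and minimal among non-bottom elements. -/
def isAtomDef {n : ℕ} (i : Fin n) : BF n :=
  ∼(isBot' i) ⊓
    ∀' (sub' (Fin.last n) i.castSucc ⟹ (isBot' (Fin.last n) ⊔ eq' (Fin.last n) i.castSucc))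

/-! ### The base theory `T_base` -/

def axRefl : Lmso.Sentence := ∀' sub' 0 0
def axAntisymm : Lmso.Sentence := ∀' ∀' ((sub' 0 1 ⊓ sub' 1 0) ⟹ eq' 0 1)
def axTrans : Lmso.Sentence := ∀' ∀' ∀' ((sub' 0 1 ⊓ sub' 1 2) ⟹ sub' 0 2)
def axBotLe : Lmso.Sentence := ∀' botSub' 0
def axTop : Lmso.Sentence := ∃' ∀' (sub' 1 0)
def axMeet : Lmso.Sentence := ∀' ∀' ∃' (isMeet 2 0 1)
def axJoin : Lmso.Sentence := ∀' ∀' ∃' (isJoin 2 0 1)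
def axCompl : Lmso.Sentence := ∀' ∃' (isComplOf 1 0)
def axDistrib : Lmso.Sentence :=
  ∀' ∀' ∀' ∀' ∀' ∀' ∀' ∀'
    ((isMeet 3 0 1 ⊓ isMeet 4 0 2 ⊓ isJoin 5 1 2 ⊓ isMeet 6 0 5 ⊓ isJoin 7 3 4) ⟹ sub' 6 7)
def axAt : Lmso.Sentence := ∀' (at' 0 ⇔ isAtomDef 0)
def axAtomic : Lmso.Sentence := ∀' (∼(isBot' 0) ⟹ ∃' (at' 1 ⊓ sub' 1 0))
def axIrrefl : Lmso.Sentence := ∀' (at' 0 ⟹ ∼(exle' 0 0))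
def axTransAt : Lmso.Sentence :=
  ∀' ∀' ∀' ((at' 0 ⊓ at' 1 ⊓ at' 2 ⊓ exle' 0 1 ⊓ exle' 1 2) ⟹ exle' 0 2)
def axTrich : Lmso.Sentence :=
  ∀' ∀' ((at' 0 ⊓ at' 1) ⟹ (exle' 0 1 ⊔ eq' 0 1 ⊔ exle' 1 0))
def axExleDef : Lmso.Sentence :=
  ∀' ∀' (exle' 0 1 ⇔ ∃' ∃' (at' 2 ⊓ at' 3 ⊓ sub' 2 0 ⊓ sub' 3 1 ⊓ exle' 2 3))

/-- The comprehension axiom for a formula `η(x; Y₁,…,Yₙ)` (with `x` the last variable):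
`∀ Ȳ ∃ X ∀ x (At x → (x ⊆ X ↔ η(x; Ȳ)))`. -/
def compAx {n : ℕ} (η : BF (n + 1)) : Lmso.Sentence :=
  BoundedFormula.alls (∃' ∀' (at' (Fin.last (n + 1)) ⟹
    (sub' (Fin.last (n + 1)) ((Fin.last n).castSucc) ⇔ η.liftAt 1 n)))

/-- The base theory `T_base`: an atomic Boolean algebra under `⊆` with bottom `⊥`, `At`
holding exactly of the atoms, `≤ᴱ` linearly ordering the atoms and determined by its
restriction to the atoms, together with the comprehension scheme. -/
def Tbase : Lmso.Theory :=
  {axRefl, axAntisymm, axTrans, axBotLe, axTop, axMeet, axJoin, axCompl, axDistrib,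
    axAt, axAtomic, axIrrefl, axTransAt, axTrich, axExleDef} ∪
  ⋃ n : ℕ, Set.range (compAx (n := n))

/-! ### The theory `T_MSO(Fin)` -/

/-- `i` is the `≤ᴱ`-least atom. -/
def isLeastAtom {n : ℕ} (i : Fin n) : BF n :=
  at' i ⊓ ∀' (at' (Fin.last n) ⟹ ∼(exle' (Fin.last n) i.castSucc))

/-- `i` is the `≤ᴱ`-greatest atom. -/
def isGreatestAtom {n : ℕ} (i : Fin n) : BF n :=
  at' i ⊓ ∀' (at' (Fin.last n) ⟹ ∼(exle' i.castSucc (Fin.last n)))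

/-- `j` is the immediate `≤ᴱ`-successor of the atom `i`. -/
def isSuccOf {n : ℕ} (j i : Fin n) : BF n :=
  at' i ⊓ at' j ⊓ exle' i j ⊓
    ∀' ((at' (Fin.last n) ⊓ exle' i.castSucc (Fin.last n)) ⟹
      (eq' (Fin.last n) j.castSucc ⊔ exle' j.castSucc (Fin.last n)))

def axLeastAtom : Lmso.Sentence := (∃' at' 0) ⟹ ∃' isLeastAtom 0
def axGreatestAtom : Lmso.Sentence := (∃' at' 0) ⟹ ∃' isGreatestAtom 0
def axSucc : Lmso.Sentence :=
  ∀' ((at' 0 ⊓ ∃' (at' 1 ⊓ exle' 0 1)) ⟹ ∃' isSuccOf 1 0)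
def axPred : Lmso.Sentence :=
  ∀' ((at' 0 ⊓ ∃' (at' 1 ⊓ exle' 1 0)) ⟹ ∃' isSuccOf 0 1)
def axLeastIn : Lmso.Sentence :=
  ∀' (∼(isBot' 0) ⟹ ∃' (at' 1 ⊓ sub' 1 0 ⊓ ∀' ((at' 2 ⊓ sub' 2 0) ⟹ ∼(exle' 2 1))))

/-- The theory `T_MSO(Fin)`: `T_base` together with axioms saying that the ordering of the
atoms is discrete with endpoints, and every non-bottom element contains a least atom. -/
def TMSOFin : Lmso.Theory :=
  Tbase ∪ {axLeastAtom, axGreatestAtom, axSucc, axPred, axLeastIn}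

/-! ### Quantifier rank, unnested formulas, and `≈ₖ` -/

/-- Quantifier rank of a bounded formula. -/
def qr : ∀ {n : ℕ}, BF n → ℕ
  | _, BoundedFormula.falsum => 0
  | _, BoundedFormula.equal _ _ => 0
  | _, BoundedFormula.rel _ _ => 0
  | _, BoundedFormula.imp f g => max (qr f) (qr g)
  | _, BoundedFormula.all f => qr f + 1

/-- A formula is unnested if every atomic subformula is of one of the forms
`x = y`, `c = y`, or `R x̄` with the `xᵢ`, `y` variables (Hodges). -/
def IsUnnested : ∀ {n : ℕ}, BF n → Prop
  | _, BoundedFormula.falsum => True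
  | _, BoundedFormula.equal s t =>
      (∃ i j, s = Term.var i ∧ t = Term.var j) ∨
      (∃ (c : Lmso.Constants) (j : _), s = Constants.term c ∧ t = Term.var j)
  | _, BoundedFormula.rel _ ts => ∀ i, ∃ j, ts i = Term.var j
  | _, BoundedFormula.imp f g => IsUnnested f ∧ IsUnnested g
  | _, BoundedFormula.all f => IsUnnested f

/-- `M ≈ₖ N` : `M` and `N` satisfy the same unnested `L_⊗`-sentences of quantifier
rank at most `k`. -/
def EquivK (k : ℕ) (M N : Type*) [Lmso.Structure M] [Lmso.Structure N] : Prop :=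
  ∀ φ : Lmso.Sentence, IsUnnested φ → qr φ ≤ k → (M ⊨ φ ↔ N ⊨ φ)

/-! ### The sentences `ρ_{d,h}`, `ψ_{>n}`, `ψ_{=n}` -/

/-- The index (in `Fin d`) of `A_h` among `A₁, …, A_d`, identifying `h = 0` with `h = d`. -/
def aIdx (d h : ℕ) (hd : 0 < d) : Fin d := ⟨(h + d - 1) % d, Nat.mod_lt _ hd⟩

/-- The cyclic successor on the indices `{1, …, d}`. -/
def cyc {d : ℕ} (j : Fin d) : Fin d := ⟨((j : ℕ) + 1) % d, Nat.mod_lt _ j.pos⟩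

/-- The sentence `ρ_{d,h}`: there is a partition of the atoms into `d` non-bottom elements
`A₁, …, A_d` such that the least atom is in `A₁`, the immediate successor of an atom lying in
`A_j` lies in `A_{j+1}` (cyclically), and the greatest atom is in `A_h`. -/
def rho (d h : ℕ) : Lmso.Sentence :=
  if hd : 0 < d then
    BoundedFormula.exs (n := d) (
      -- each `A_i` is non-bottom
      bigAnd ((List.finRange d).map fun i => ∼(isBot' i)) ⊓
      -- every atom lies in some `A_i`
      (∀' (at' (Fin.last d) ⟹
        bigOr ((List.finRange d).map fun i => sub' (Fin.last d) i.castSucc))) ⊓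
      -- the `A_i` are pairwise disjoint on atoms
      bigAnd ((List.finRange d).flatMap fun i => (List.finRange d).filterMap fun j =>
        if i.val < j.val then
          some (∀' (at' (Fin.last d) ⟹
            ∼(sub' (Fin.last d) i.castSucc ⊓ sub' (Fin.last d) j.castSucc)))
        else none) ⊓
      -- the least atom lies in `A₁`
      (∀' (isLeastAtom (Fin.last d) ⟹ sub' (Fin.last d) ((aIdx d 1 hd).castSucc))) ⊓
      -- immediate successors move cyclically through the `A_j`
      bigAnd ((List.finRange d).map fun j =>
        ∀' ∀' ((sub' ((Fin.last d).castSucc) (j.castSucc.castSucc) ⊓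
            isSuccOf (Fin.last (d + 1)) ((Fin.last d).castSucc)) ⟹
          sub' (Fin.last (d + 1)) ((cyc j).castSucc.castSucc))) ⊓
      -- the greatest atom lies in `A_h`
      (∀' (isGreatestAtom (Fin.last d) ⟹ sub' (Fin.last d) ((aIdx d h hd).castSucc))))
  else ⊥

/-- The list of formulas `xᵢ ≠ xⱼ` for `i < j < n`. -/
def distinctPairs (n : ℕ) : List (BF n) :=
  (List.finRange n).flatMap fun i => (List.finRange n).filterMap fun j =>
    if i.val < j.val then some (∼(eq' i j)) else none

/-- `ψ_{>n}` : there exist at least `n + 1` distinct atoms. -/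
def psiGt (n : ℕ) : Lmso.Sentence :=
  BoundedFormula.exs (n := n + 1)
    (bigAnd ((List.finRange (n + 1)).map fun i => at' i) ⊓ bigAnd (distinctPairs (n + 1)))

/-- `ψ_{=n}` : there exist exactly `n` distinct atoms. -/
def psiEq (n : ℕ) : Lmso.Sentence :=
  BoundedFormula.exs (n := n)
    (bigAnd ((List.finRange n).map fun i => at' i) ⊓ bigAnd (distinctPairs n) ⊓
      ∀' (at' (Fin.last n) ⟹ bigOr ((List.finRange n).map fun i => eq' (Fin.last n) i.castSucc)))

/-! ### Residue functions and the theories `T_r̃` -/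

/-- A residue function `ℙ × ℕ_{>0} → ℕ` (conditions imposed only at primes `p` and `j ≥ 1`):
`r(p,j) < p^j` and `r(p,j+1) ≡ r(p,j) [MOD p^j]`. -/
def IsResidueFunction (r : ℕ → ℕ → ℕ) : Prop :=
  ∀ p j : ℕ, p.Prime → 1 ≤ j → r p j < p ^ j ∧ r p (j + 1) ≡ r p j [MOD p ^ j]

/-- A function `ℕ_{>1} → ℕ` is a residue function if it arises from a residue function
`ℙ × ℕ_{>0} → ℕ` as in the paper (conditions imposed only for `d > 1`). -/
def IsResidueFunctionTilde (rt : ℕ → ℕ) : Prop :=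
  ∃ r : ℕ → ℕ → ℕ, IsResidueFunction r ∧
    ∀ d : ℕ, 1 < d → rt d < d ∧
      ∀ p j : ℕ, p.Prime → 1 ≤ j → p ^ j ∣ d → rt d ≡ r p j [MOD p ^ j]

/-- The theory `T_r̃ = T_MSO(Fin) ∪ {ψ_{>n} : n ∈ ℕ} ∪ {ρ_{d,r̃(d)} : d > 1}`. -/
def Trt (rt : ℕ → ℕ) : Lmso.Theory :=
  TMSOFin ∪ Set.range psiGt ∪ {σ : Lmso.Sentence | ∃ d : ℕ, 1 < d ∧ σ = rho d (rt d)}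

/-! ### Relativization and the sum of sentences -/

/-- Relativization of a formula to the elements `⊆ v`:
each quantifier `∀ Z (…)` becomes `∀ Z (Z ⊆ v → …)`. -/
def relv : ∀ {n : ℕ}, BF n → Fin n → BF n
  | _, BoundedFormula.falsum, _ => BoundedFormula.falsum
  | _, BoundedFormula.equal s t, _ => BoundedFormula.equal s t
  | _, BoundedFormula.rel r ts, _ => BoundedFormula.rel r ts
  | _, BoundedFormula.imp f g, v => (relv f v).imp (relv g v)
  | n, BoundedFormula.all f, v =>
      BoundedFormula.all (sub' (Fin.last n) v.castSucc ⟹ relv f v.castSucc)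

/-- `i` is downward closed with respect to the `≤ᴱ`-ordering of the atoms. -/
def dwcl' {n : ℕ} (i : Fin n) : BF n :=
  ∀' ∀' ((at' ((Fin.last n).castSucc) ⊓ at' (Fin.last (n + 1)) ⊓
      sub' ((Fin.last n).castSucc) (i.castSucc.castSucc) ⊓
      exle' (Fin.last (n + 1)) ((Fin.last n).castSucc)) ⟹
    sub' (Fin.last (n + 1)) (i.castSucc.castSucc))

/-- The sentence `φ + ψ` : `∃ X (X downward closed ∧ φ^X ∧ ψ^(Xᶜ))`
(with the complement `Xᶜ` introduced by an existential quantifier). -/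
def plusSent (φ ψ : Lmso.Sentence) : Lmso.Sentence :=
  ∃' ∃' (dwcl' (0 : Fin 2) ⊓ isComplOf (1 : Fin 2) (0 : Fin 2) ⊓
    relv (φ.liftAt 2 0) (0 : Fin 2) ⊓ relv (ψ.liftAt 2 0) (1 : Fin 2))

/-! ### `FSpec` and ultimate periodicity -/

/-- `FSpec φ` : the set of `n ∈ ℕ` such that `MSO(n) ⊨ φ`. -/
def FSpec (φ : Lmso.Sentence) : Set ℕ := {n : ℕ | MSOn n ⊨ φ}

/-- A set of naturals is ultimately periodic. -/
def UltPeriodic (S : Set ℕ) : Prop :=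
  ∃ N d : ℕ, 0 < d ∧ ∀ n : ℕ, N < n → (n ∈ S ↔ n + d ∈ S)

/-! ### The language `L_MO = {⊆, <}` -/

/-- The language `L_MO` with two binary relations: `⊆` (encoded `true`) and `<`
(encoded `false`). -/
def Lmo : Language where
  Functions := fun _ => Empty
  Relations := fun n => match n with | 2 => Bool | _ => Empty

/-- The monadic second order version `MSO(α)` of a linear order `α` as an `L_MO`-structure:
`⊆` is inclusion and `<` is the ordering of `α` on singletons. -/
instance moStructure (α : Type*) [LinearOrder α] : Lmo.Structure (Set α) where
  funMap := fun f _ => f.elim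
  RelMap := fun {n} r v => match n, r with
    | 2, true => v 0 ⊆ v 1
    | 2, false => ∃ a b : α, v 0 = {a} ∧ v 1 = {b} ∧ a < b

/-! ### Realization of the basic formulas -/

section Realize

variable {M : Type*} [Lmso.Structure M] {n : ℕ} (v : Empty → M) (xs : Fin n → M)

/-- The value of a variable, or of the constant `⊥`. -/
def optVal (xs : Fin n → M) (o : Option (Fin n)) : M := o.elim (botE M) xs

@[simp] lemma optVal_none : optVal xs none = botE M := rfl

@[simp] lemma optVal_some (i : Fin n) : optVal xs (some i) = xs i := rfl

/-- The variable occurring in a term, with `none` for the constant `⊥`. -/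
def termOpt : Lmso.Term (Empty ⊕ Fin n) → Option (Fin n)
  | Term.var (Sum.inr i) => some i
  | _ => none

lemma realize_term_eq (t : Lmso.Term (Empty ⊕ Fin n)) :
    t.realize (Sum.elim v xs) = optVal xs (termOpt t) := by
  match t with
  | Term.var (Sum.inr i) => rfl
  | Term.var (Sum.inl e) => exact e.elim
  | Term.func (l := 0) f ts =>
    cases f
    exact congrArg (Structure.funMap botC) (Subsingleton.elim (α := Fin 0 → M) _ _)
  | Term.func (l := _ + 1) f ts => exact f.elim

@[simp] lemma realize_tv (i : Fin n) : (tv i).realize (Sum.elim v xs) = xs i := rfl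

@[simp] lemma realize_tb : (tb : Lmso.Term (Empty ⊕ Fin n)).realize (Sum.elim v xs) = botE M := by
  rw [realize_term_eq]; rfl

@[simp] lemma realize_sub' (i j : Fin n) :
    (sub' i j).Realize v xs ↔ subE (xs i) (xs j) := by
  simp [sub', subE, BoundedFormula.realize_rel₂]

@[simp] lemma realize_exle' (i j : Fin n) :
    (exle' i j).Realize v xs ↔ exleE (xs i) (xs j) := by
  simp [exle', exleE, BoundedFormula.realize_rel₂]

@[simp] lemma realize_at' (i : Fin n) : (at' i).Realize v xs ↔ atE (xs i) := by
  simp [at', atE, BoundedFormula.realize_rel₁]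

@[simp] lemma realize_eq' (i j : Fin n) : (eq' i j).Realize v xs ↔ xs i = xs j := by
  simp [eq']

@[simp] lemma realize_isBot' (i : Fin n) : (isBot' i).Realize v xs ↔ xs i = botE M := by
  simp [isBot']

@[simp] lemma realize_botSub' (i : Fin n) :
    (botSub' i).Realize v xs ↔ subE (botE M) (xs i) := by
  simp [botSub', subE, BoundedFormula.realize_rel₂]

lemma relMap_one (R : Lmso.Relations 1) (f : Fin 1 → M) : Structure.RelMap R f ↔ atE (f 0) := by
  cases R
  exact iff_of_eq (congrArg (Structure.RelMap atR) (funext fun i => by fin_cases i; rfl))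

lemma relMap_two (R : Lmso.Relations 2) (f : Fin 2 → M) : Structure.RelMap R f ↔
    R = subR ∧ subE (f 0) (f 1) ∨ R = exleR ∧ exleE (f 0) (f 1) := by
  have e : f = ![f 0, f 1] := funext fun i => by fin_cases i <;> rfl
  cases R
  · refine (iff_of_eq (congrArg (Structure.RelMap exleR) e)).trans ?_
    refine ⟨fun h => Or.inr ⟨rfl, h⟩, ?_⟩
    rintro (⟨h, -⟩ | ⟨-, h⟩)
    · exact (Bool.false_ne_true h).elim
    · exact h
  · refine (iff_of_eq (congrArg (Structure.RelMap subR) e)).trans ?_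
    refine ⟨fun h => Or.inl ⟨rfl, h⟩, ?_⟩
    rintro (⟨-, h⟩ | ⟨h, -⟩)
    · exact h
    · exact (Bool.false_ne_true h.symm).elim

lemma realize_sentence_iff (φ : Lmso.Sentence) (xs : Fin 0 → M) :
    M ⊨ φ ↔ BoundedFormula.Realize φ v xs := by
  rw [Sentence.Realize, Formula.Realize, Subsingleton.elim v default,
    Subsingleton.elim xs default]

end Realize

/-! ### Back-and-forth types -/

/-- The possible atomic types of `n`-tuples. -/
abbrev AtomTy (n : ℕ) : Type :=
  (Option (Fin n) → Option (Fin n) → Prop × Prop × Prop) × (Option (Fin n) → Prop)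

/-- The possible types of `n`-tuples of back-and-forth rank `k`. -/
def Ty : ℕ → ℕ → Type
  | 0, n => AtomTy n
  | k + 1, n => Set (Ty k (n + 1))

instance finite_ty : ∀ k n : ℕ, Finite (Ty k n)
  | 0, n => inferInstanceAs (Finite (AtomTy n))
  | k + 1, n =>
    have := finite_ty k (n + 1)
    inferInstanceAs (Finite (Set (Ty k (n + 1))))

/-- The type of rank `k` of a tuple. -/
def tp {M : Type*} [Lmso.Structure M] : ∀ (k : ℕ) {n : ℕ}, (Fin n → M) → Ty k n
  | 0, _, xs => ((fun i j => (subE (optVal xs i) (optVal xs j), exleE (optVal xs i) (optVal xs j),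
      optVal xs i = optVal xs j), fun i => atE (optVal xs i)) : AtomTy _)
  | k + 1, _, xs => {t | ∃ m, tp k (Fin.snoc (α := fun _ => M) xs m) = t}

section Types

variable {M N : Type*} [Lmso.Structure M] [Lmso.Structure N] {n : ℕ}

lemma tp_zero_eq_iff {xs : Fin n → M} {t : Ty 0 n} :
    tp 0 xs = t ↔ (∀ i j, (subE (optVal xs i) (optVal xs j) ↔ (t.1 i j).1) ∧
      (exleE (optVal xs i) (optVal xs j) ↔ (t.1 i j).2.1) ∧
      (optVal xs i = optVal xs j ↔ (t.1 i j).2.2)) ∧ ∀ i, atE (optVal xs i) ↔ t.2 i := by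
  refine Prod.ext_iff.trans (and_congr (funext_iff.trans (forall_congr' fun i =>
    funext_iff.trans (forall_congr' fun j => ?_))) (funext_iff.trans (forall_congr' fun i => ?_)))
  · simp only [tp, Prod.ext_iff, eq_iff_iff]
  · simp only [tp, eq_iff_iff]

lemma tp_zero_eq_tp_iff {xs : Fin n → M} {ys : Fin n → N} :
    tp 0 xs = tp 0 ys ↔ (∀ i j, (subE (optVal xs i) (optVal xs j) ↔
        subE (optVal ys i) (optVal ys j)) ∧
      (exleE (optVal xs i) (optVal xs j) ↔ exleE (optVal ys i) (optVal ys j)) ∧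
      (optVal xs i = optVal xs j ↔ optVal ys i = optVal ys j)) ∧
      ∀ i, atE (optVal xs i) ↔ atE (optVal ys i) :=
  tp_zero_eq_iff

lemma tp_succ_eq_tp_iff {k : ℕ} {xs : Fin n → M} {ys : Fin n → N} :
    tp (k + 1) xs = tp (k + 1) ys ↔
      (∀ a : M, ∃ b : N, tp k (Fin.snoc (α := fun _ => M) xs a) =
        tp k (Fin.snoc (α := fun _ => N) ys b)) ∧
      ∀ b : N, ∃ a : M, tp k (Fin.snoc (α := fun _ => M) xs a) =
        tp k (Fin.snoc (α := fun _ => N) ys b) := by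
  constructor
  · intro h
    refine ⟨fun a => ?_, fun b => ?_⟩
    · obtain ⟨b, hb⟩ := (Set.ext_iff.1 h _).1 ⟨a, rfl⟩
      exact ⟨b, hb.symm⟩
    · exact (Set.ext_iff.1 h (tp k _)).2 ⟨b, rfl⟩
  · rintro ⟨h1, h2⟩
    refine Set.ext fun t => ⟨?_, ?_⟩
    · rintro ⟨a, rfl⟩
      obtain ⟨b, hb⟩ := h1 a
      exact ⟨b, hb.symm⟩
    · rintro ⟨b, rfl⟩
      exact h2 b

lemma optVal_snoc_map (xs : Fin n → M) (a : M) (o : Option (Fin n)) :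
    optVal (Fin.snoc (α := fun _ => M) xs a) (o.map Fin.castSucc) = optVal xs o := by
  cases o <;> simp

lemma tp_pred {k : ℕ} {xs : Fin n → M} {ys : Fin n → N} (h : tp (k + 1) xs = tp (k + 1) ys) :
    tp k xs = tp k ys := by
  induction k generalizing n with
  | zero =>
    obtain ⟨b, hb⟩ := (tp_succ_eq_tp_iff.1 h).1 (botE M)
    rw [tp_zero_eq_tp_iff] at hb ⊢
    refine ⟨fun i j => ?_, fun i => ?_⟩
    · simpa only [optVal_snoc_map] using hb.1 (i.map Fin.castSucc) (j.map Fin.castSucc)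
    · simpa only [optVal_snoc_map] using hb.2 (i.map Fin.castSucc)
  | succ k ih =>
    rw [tp_succ_eq_tp_iff] at h ⊢
    exact ⟨fun a => (h.1 a).imp fun _ => ih, fun b => (h.2 b).imp fun _ => ih⟩

lemma tp_mono {k l : ℕ} (hkl : k ≤ l) {xs : Fin n → M} {ys : Fin n → N}
    (h : tp l xs = tp l ys) : tp k xs = tp k ys := by
  induction hkl with
  | refl => exact h
  | step _ ih => exact ih (tp_pred h)

lemma realize_iff_of_tp_eq (φ : BF n) {k : ℕ} (hk : qr φ ≤ k) (v : Empty → M) (w : Empty → N)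
    {xs : Fin n → M} {ys : Fin n → N} (h : tp k xs = tp k ys) :
    φ.Realize v xs ↔ φ.Realize w ys := by
  induction φ generalizing k with
  | falsum => rfl
  | equal t₁ t₂ =>
    simp only [BoundedFormula.Realize, realize_term_eq]
    exact ((tp_zero_eq_tp_iff.1 (tp_mono k.zero_le h)).1 _ _).2.2
  | @rel n l R ts =>
    obtain ⟨h1, h2⟩ := tp_zero_eq_tp_iff.1 (tp_mono k.zero_le h)
    simp only [BoundedFormula.Realize, realize_term_eq]
    match l, R with
    | 1, R => simpa only [relMap_one] using h2 _
    | 2, R => simp only [relMap_two, (h1 _ _).1, (h1 _ _).2.1]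
  | imp f g ihf ihg =>
    simp only [qr, max_le_iff] at hk
    simp only [BoundedFormula.Realize, ihf hk.1 h, ihg hk.2 h]
  | all f ih =>
    obtain _ | k := k
    · simp [qr] at hk
    simp only [qr, Nat.add_le_add_iff_right] at hk
    rw [tp_succ_eq_tp_iff] at h
    simp only [BoundedFormula.Realize]
    refine ⟨fun H b => ?_, fun H a => ?_⟩
    · obtain ⟨a, ha⟩ := h.2 b
      exact (ih hk ha).1 (H a)
    · obtain ⟨b, hb⟩ := h.1 a
      exact (ih hk hb).2 (H b)

lemma sentence_iff_of_tp_eq (φ : Lmso.Sentence) (xs : Fin 0 → M) (ys : Fin 0 → N)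
    (h : tp (qr φ) xs = tp (qr φ) ys) : M ⊨ φ ↔ N ⊨ φ := by
  rw [realize_sentence_iff default φ xs, realize_sentence_iff default φ ys]
  exact realize_iff_of_tp_eq φ le_rfl _ _ h

end Types

/-- The term denoting a variable, or `⊥` for `none`. -/
def optTerm {n : ℕ} (o : Option (Fin n)) : Lmso.Term (Empty ⊕ Fin n) := o.elim tb tv

lemma realize_optTerm {M : Type*} [Lmso.Structure M] {n : ℕ} (v : Empty → M) (xs : Fin n → M)
    (o : Option (Fin n)) : (optTerm o).realize (Sum.elim v xs) = optVal xs o := by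
  cases o <;> simp [optTerm]

lemma exists_literal {n : ℕ} (φ : BF n) (P : Prop) : ∃ η : BF n, ∀ (M : Type) [Lmso.Structure M]
    (v : Empty → M) (xs : Fin n → M), η.Realize v xs ↔ (φ.Realize v xs ↔ P) := by
  by_cases hP : P
  · exact ⟨φ, by simp [hP]⟩
  · exact ⟨∼φ, by simp [hP]⟩

/-- Every type is defined by a formula. -/
lemma exists_hintikka (k n : ℕ) (t : Ty k n) : ∃ η : BF n, ∀ (M : Type) [Lmso.Structure M]
    (v : Empty → M) (xs : Fin n → M), η.Realize v xs ↔ tp k xs = t := by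
  induction k generalizing n with
  | zero =>
    choose f hf using fun i j : Option (Fin n) =>
      exists_literal (subR.boundedFormula₂ (optTerm i) (optTerm j)) (t.1 i j).1
    choose g hg using fun i j : Option (Fin n) =>
      exists_literal (exleR.boundedFormula₂ (optTerm i) (optTerm j)) (t.1 i j).2.1
    choose e he using fun i j : Option (Fin n) =>
      exists_literal (Term.bdEqual (optTerm i) (optTerm j)) (t.1 i j).2.2
    choose a ha using fun i : Option (Fin n) =>
      exists_literal (atR.boundedFormula₁ (optTerm i)) (t.2 i)
    refine ⟨(BoundedFormula.iInf fun i => BoundedFormula.iInf fun j => f i j ⊓ (g i j ⊓ e i j)) ⊓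
      BoundedFormula.iInf a, fun M _ v xs => ?_⟩
    rw [tp_zero_eq_iff]
    simp [BoundedFormula.realize_iInf, hf, hg, he, ha, realize_optTerm,
      BoundedFormula.realize_rel₁, BoundedFormula.realize_rel₂, subE, exleE, atE]
  | succ k ih =>
    choose H hH using ih (n + 1)
    choose f hf using fun s : Ty k (n + 1) => exists_literal (∃' (H s)) (Set.Mem t s)
    refine ⟨BoundedFormula.iInf f, fun M _ v xs => ?_⟩
    simp only [BoundedFormula.realize_iInf, hf, BoundedFormula.realize_ex, hH]
    exact (Set.ext_iff (α := Ty k (n + 1))).symm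

lemma exists_sentence_tp_mem (k : ℕ) (F : Set (Ty k 0)) : ∃ η : Lmso.Sentence,
    ∀ (M : Type) [Lmso.Structure M] (xs : Fin 0 → M), M ⊨ η ↔ tp k xs ∈ F := by
  choose H hH using exists_hintikka k 0
  refine ⟨BoundedFormula.iSup fun t : F => H t, fun M _ xs => ?_⟩
  rw [realize_sentence_iff default _ xs, BoundedFormula.realize_iSup]
  simp [hH]

/-! ### Embeddings -/

section Embeddings

variable {M N : Type*} [Lmso.Structure M] [Lmso.Structure N]

lemma funMap_eq_botE (f : Lmso.Functions 0) (xs : Fin 0 → M) : Structure.funMap f xs = botE M := by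
  cases f
  exact congrArg (Structure.funMap botC) (Subsingleton.elim (α := Fin 0 → M) _ _)

/-- An injective map respecting the four symbols of the language is an embedding. -/
def mkEmb (g : M → N) (hg : Function.Injective g) (hbot : g (botE M) = botE N)
    (hsub : ∀ a b, subE (g a) (g b) ↔ subE a b) (hexle : ∀ a b, exleE (g a) (g b) ↔ exleE a b)
    (hat : ∀ a, atE (g a) ↔ atE a) : M ↪[Lmso] N where
  toFun := g
  inj' := hg
  map_fun' {n} f x := by
    match n, f with
    | 0, f => rw [funMap_eq_botE, funMap_eq_botE, hbot]
  map_rel' {n} r x := by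
    match n, r with
    | 1, r => simp only [relMap_one, Function.comp_apply, hat]
    | 2, r => simp only [relMap_two, Function.comp_apply, hsub, hexle]

variable (g : M ↪[Lmso] N)

@[simp] lemma emb_bot : g (botE M) = botE N :=
  (g.map_fun botC ![]).trans (funMap_eq_botE _ _)

@[simp] lemma emb_sub (a b : M) : subE (g a) (g b) ↔ subE a b := by
  have := g.map_rel subR ![a, b]
  simpa only [relMap_two, Function.comp_apply, true_and, Matrix.cons_val_zero,
    Matrix.cons_val_one, show subR ≠ exleR from Bool.true_eq_false_eq_False, false_and,
    or_false] using this

@[simp] lemma emb_exle (a b : M) : exleE (g a) (g b) ↔ exleE a b := by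
  have := g.map_rel exleR ![a, b]
  simpa only [relMap_two, Function.comp_apply, true_and, Matrix.cons_val_zero,
    Matrix.cons_val_one, show exleR ≠ subR from fun h => Bool.false_ne_true h, false_and,
    false_or] using this

@[simp] lemma emb_at (a : M) : atE (g a) ↔ atE a := by
  have := g.map_rel atR ![a]
  simpa only [relMap_one, Function.comp_apply, Matrix.cons_val_zero] using this

/-- Structures embedding with the same range satisfy the same sentences. -/
lemma sentence_iff_of_range_eq {P : Type*} [Lmso.Structure P] (g : M ↪[Lmso] P)
    (h : N ↪[Lmso] P) (H : Set.range g = Set.range h) (φ : Lmso.Sentence) : M ⊨ φ ↔ N ⊨ φ := by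
  have e : g.toHom.range = h.toHom.range := SetLike.coe_injective (by
    rw [Hom.range_coe, Hom.range_coe]; exact H)
  exact (StrongHomClass.realize_sentence g.equivRange φ).trans
    ((by rw [e] : (g.toHom.range ⊨ φ) ↔ (h.toHom.range ⊨ φ)).trans
      (StrongHomClass.realize_sentence h.equivRange φ).symm)

end Embeddings

section Powerset

variable {α β : Type*} [LinearOrder α] [LinearOrder β]

@[simp] lemma botE_set : botE (Set α) = ∅ := rfl

@[simp] lemma subE_set (A B : Set α) : subE A B ↔ A ⊆ B := Iff.rfl

@[simp] lemma exleE_set (A B : Set α) : exleE A B ↔ ∃ a ∈ A, ∃ b ∈ B, a < b := Iff.rfl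

@[simp] lemma atE_set (A : Set α) : atE A ↔ ∃ a, A = {a} := Iff.rfl

/-- The embedding of powerset structures given by direct images under an order embedding. -/
def imageEmb (f : α ↪o β) : Set α ↪[Lmso] Set β :=
  mkEmb (f '' ·) f.injective.image_injective (Set.image_empty _)
    (fun A B => Set.image_subset_image_iff f.injective)
    (fun A B => by simp) (fun A => by
      constructor
      · rintro ⟨b, hb : f '' A = {b}⟩
        obtain ⟨a, -, rfl⟩ : b ∈ f '' A := hb ▸ rfl
        exact ⟨a, f.injective.image_injective (hb.trans Set.image_singleton.symm)⟩
      · rintro ⟨a, rfl⟩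
        exact ⟨f a, Set.image_singleton⟩)

@[simp] lemma imageEmb_apply (f : α ↪o β) (A : Set α) : imageEmb f A = f '' A := rfl

end Powerset

/-! ### Adding a last point -/

section AddPoint

/-- `A` with the point `x` added if `ε` holds. -/
def addPt {α : Type*} (x : α) (A : Set α) (ε : Prop) : Set α := {y | y ∈ A ∨ y = x ∧ ε}

/-- `P` arises from `A` by adding a new last point `x` to the underlying order. -/
structure OneStep {A P α : Type*} [Lmso.Structure A] [Lmso.Structure P] [LinearOrder α] (x : α)
    (g : A ↪[Lmso] Set α) (h : P ↪[Lmso] Set α) : Prop where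
  lt : ∀ a, ∀ y ∈ g a, y < x
  exists_left : ∀ p, ∃ a ε, h p = addPt x (g a) ε
  exists_right : ∀ a ε, ∃ p, h p = addPt x (g a) ε

variable {A P α : Type*} [Lmso.Structure A] [Lmso.Structure P] [LinearOrder α] {x : α}
  {g : A ↪[Lmso] Set α} {h : P ↪[Lmso] Set α}

lemma OneStep.mem_iff (H : OneStep x g h) {a : A} {p : P} {ε : Prop}
    (e : h p = addPt x (g a) ε) (y : α) : y ∈ h p ↔ y < x ∧ y ∈ g a ∨ y = x ∧ ε := by
  rw [e]
  exact or_congr_left ⟨fun hy => ⟨H.lt _ _ hy, hy⟩, And.right⟩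

lemma OneStep.sub_iff (H : OneStep x g h) {a b : A} {p q : P} {ε δ : Prop}
    (hp : h p = addPt x (g a) ε) (hq : h q = addPt x (g b) δ) :
    subE p q ↔ subE a b ∧ (ε → δ) := by
  rw [← emb_sub h, ← emb_sub g, subE_set, subE_set]
  constructor
  · refine fun hs => ⟨fun y hy => ?_, fun hε => ?_⟩
    · have := hs ((H.mem_iff hp y).2 (Or.inl ⟨H.lt _ _ hy, hy⟩))
      rw [H.mem_iff hq] at this
      obtain h | h := this
      · exact h.2
      · exact absurd h.1 (H.lt _ _ hy).ne
    · have := hs ((H.mem_iff hp x).2 (Or.inr ⟨rfl, hε⟩))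
      rw [H.mem_iff hq] at this
      simpa using this
  · rintro ⟨h1, h2⟩ y hy
    rw [H.mem_iff hp] at hy
    exact (H.mem_iff hq y).2 (hy.imp (And.imp_right (@h1 y)) (And.imp_right h2))

lemma OneStep.eq_iff (H : OneStep x g h) {a b : A} {p q : P} {ε δ : Prop}
    (hp : h p = addPt x (g a) ε) (hq : h q = addPt x (g b) δ) :
    p = q ↔ a = b ∧ (ε ↔ δ) := by
  have h1 : p = q ↔ subE p q ∧ subE q p := by
    rw [← h.injective.eq_iff, ← emb_sub h, ← emb_sub h]; exact Set.Subset.antisymm_iff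
  have h2 : a = b ↔ subE a b ∧ subE b a := by
    rw [← g.injective.eq_iff, ← emb_sub g, ← emb_sub g]; exact Set.Subset.antisymm_iff
  rw [h1, h2, H.sub_iff hp hq, H.sub_iff hq hp]
  tauto

lemma OneStep.exle_iff (H : OneStep x g h) {a b : A} {p q : P} {ε δ : Prop}
    (hp : h p = addPt x (g a) ε) (hq : h q = addPt x (g b) δ) :
    exleE p q ↔ exleE a b ∨ a ≠ botE A ∧ δ := by
  have hne : a ≠ botE A ↔ (g a).Nonempty := by
    rw [Ne, ← g.injective.eq_iff, emb_bot, botE_set, Set.nonempty_iff_ne_empty]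
  rw [← emb_exle h, ← emb_exle g, exleE_set, exleE_set, hne]
  constructor
  · rintro ⟨y, hy, z, hz, hyz⟩
    rw [H.mem_iff hp] at hy
    rw [H.mem_iff hq] at hz
    obtain ⟨hyx, hy⟩ | ⟨rfl, -⟩ := hy
    · obtain ⟨-, hz⟩ | ⟨rfl, hδ⟩ := hz
      · exact Or.inl ⟨y, hy, z, hz, hyz⟩
      · exact Or.inr ⟨⟨y, hy⟩, hδ⟩
    · obtain ⟨hz, -⟩ | ⟨rfl, -⟩ := hz
      · exact absurd hz hyz.asymm
      · exact absurd hyz (lt_irrefl _)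
  · rintro (⟨y, hy, z, hz, hyz⟩ | ⟨⟨y, hy⟩, hδ⟩)
    · exact ⟨y, (H.mem_iff hp y).2 (Or.inl ⟨H.lt _ _ hy, hy⟩), z,
        (H.mem_iff hq z).2 (Or.inl ⟨H.lt _ _ hz, hz⟩), hyz⟩
    · exact ⟨y, (H.mem_iff hp y).2 (Or.inl ⟨H.lt _ _ hy, hy⟩), x,
        (H.mem_iff hq x).2 (Or.inr ⟨rfl, hδ⟩), H.lt _ _ hy⟩

lemma OneStep.at_iff (H : OneStep x g h) {a : A} {p : P} {ε : Prop}
    (hp : h p = addPt x (g a) ε) :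
    atE p ↔ atE a ∧ ¬ε ∨ a = botE A ∧ ε := by
  have hbot : a = botE A ↔ g a = ∅ := by rw [← g.injective.eq_iff, emb_bot, botE_set]
  rw [← emb_at h, ← emb_at g, atE_set, atE_set, hbot, hp]
  by_cases hε : ε
  · simp only [addPt, hε, and_true, not_true_eq_false, and_false, false_or]
    constructor
    · rintro ⟨y, hy⟩
      have hx : x = y := (Set.ext_iff.1 hy x).1 (Or.inr rfl)
      refine Set.eq_empty_of_forall_notMem fun z hz => ?_
      have hzy : z = y := (Set.ext_iff.1 hy z).1 (Or.inl hz)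
      exact (H.lt _ _ hz).ne (hzy.trans hx.symm)
    · intro h
      exact ⟨x, by ext z; simp [h]⟩
  · simp [addPt, hε]

/-- The type of the extension by a last point is determined by the type of the original. -/
lemma OneStep.tp_eq {A' P' α' : Type*} [Lmso.Structure A'] [Lmso.Structure P'] [LinearOrder α']
    {x' : α'} {g' : A' ↪[Lmso] Set α'} {h' : P' ↪[Lmso] Set α'} (H : OneStep x g h)
    (H' : OneStep x' g' h') (k : ℕ) {n : ℕ} (a : Fin n → A) (a' : Fin n → A') (p : Fin n → P)
    (p' : Fin n → P') (ε : Fin n → Prop) (hp : ∀ i, h (p i) = addPt x (g (a i)) (ε i))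
    (hp' : ∀ i, h' (p' i) = addPt x' (g' (a' i)) (ε i)) (haa' : tp k a = tp k a') :
    tp k p = tp k p' := by
  induction k generalizing n with
  | zero =>
    have e : ∀ o, h (optVal p o) = addPt x (g (optVal a o)) (o.elim False ε) := by
      rintro (_ | i)
      · simp [addPt]
      · exact hp i
    have e' : ∀ o, h' (optVal p' o) = addPt x' (g' (optVal a' o)) (o.elim False ε) := by
      rintro (_ | i)
      · simp [addPt]
      · exact hp' i
    rw [tp_zero_eq_tp_iff] at haa' ⊢
    have hbot : ∀ i, optVal a i = botE A ↔ optVal a' i = botE A' := fun i => by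
      simpa using (haa'.1 i none).2.2
    refine ⟨fun i j => ⟨?_, ?_, ?_⟩, fun i => ?_⟩
    · rw [H.sub_iff (e i) (e j), H'.sub_iff (e' i) (e' j), (haa'.1 i j).1]
    · rw [H.exle_iff (e i) (e j), H'.exle_iff (e' i) (e' j), (haa'.1 i j).2.1, Ne, Ne, hbot]
    · rw [H.eq_iff (e i) (e j), H'.eq_iff (e' i) (e' j), (haa'.1 i j).2.2]
    · rw [H.at_iff (e i), H'.at_iff (e' i), haa'.2, hbot]
  | succ k ih =>
    rw [tp_succ_eq_tp_iff] at haa' ⊢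
    constructor
    · intro q
      obtain ⟨b, δ, hq⟩ := H.exists_left q
      obtain ⟨b', hb'⟩ := haa'.1 b
      obtain ⟨q', hq'⟩ := H'.exists_right b' δ
      refine ⟨q', ih _ _ _ _ (Fin.snoc (α := fun _ => Prop) ε δ) ?_ ?_ hb'⟩
      · exact Fin.lastCases (by simpa) (by simpa)
      · exact Fin.lastCases (by simpa) (by simpa)
    · intro q'
      obtain ⟨b', δ, hq'⟩ := H'.exists_left q'
      obtain ⟨b, hb⟩ := haa'.2 b'
      obtain ⟨q, hq⟩ := H.exists_right b δ
      refine ⟨q, ih _ _ _ _ (Fin.snoc (α := fun _ => Prop) ε δ) ?_ ?_ hb⟩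
      · exact Fin.lastCases (by simpa) (by simpa)
      · exact Fin.lastCases (by simpa) (by simpa)

lemma oneStep_fin (n : ℕ) : OneStep (Fin.last n) (imageEmb Fin.castSuccOrderEmb)
    (Embedding.refl Lmso (Set (Fin (n + 1)))) where
  lt a y := by
    rintro ⟨z, -, rfl⟩
    exact Fin.castSucc_lt_last z
  exists_left p := by
    refine ⟨Fin.castSucc ⁻¹' p, Fin.last n ∈ p, ?_⟩
    ext y
    refine Fin.lastCases ?_ (fun i => ?_) y <;> simp [addPt, (Fin.castSucc_ne_last _)]
  exists_right a ε := ⟨_, rfl⟩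

/-- The type of the finite order with `n` elements. -/
def finTp (k n : ℕ) : Ty k 0 := tp k (Fin.elim0 : Fin 0 → MSOn n)

lemma OneStep.tp_eq_finTp_succ (H : OneStep x g h) {k m : ℕ} (a : Fin 0 → A) (p : Fin 0 → P)
    (e : tp k a = finTp k m) : tp k p = finTp k (m + 1) :=
  H.tp_eq (oneStep_fin m) k a _ p _ Fin.elim0 (fun i => i.elim0) (fun i => i.elim0) e

lemma finTp_succ_congr {k m n : ℕ} (e : finTp k m = finTp k n) :
    finTp k (m + 1) = finTp k (n + 1) :=
  (oneStep_fin m).tp_eq_finTp_succ _ _ e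

end AddPoint

/-- Büchi's theorem on finite orders: spectra are ultimately periodic. -/
lemma ultPeriodic_FSpec (φ : Lmso.Sentence) : UltPeriodic (FSpec φ) := by
  obtain ⟨a, b, hne, hab⟩ := Finite.exists_ne_map_eq_of_infinite (finTp (qr φ))
  wlog hlt : a < b generalizing a b
  · exact this b a hne.symm hab.symm (hne.lt_or_gt.resolve_left hlt)
  refine ⟨a, b - a, by omega, fun n hn => ?_⟩
  have key : ∀ i, finTp (qr φ) (a + i) = finTp (qr φ) (b + i) := fun i => by
    induction i with
    | zero => exact hab
    | succ i ih => exact finTp_succ_congr ih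
  have := key (n - a)
  rw [show a + (n - a) = n by omega, show b + (n - a) = n + (b - a) by omega] at this
  exact sentence_iff_of_tp_eq φ _ _ this

/-! ### Relativization -/

lemma realize_relv {M N : Type*} [Lmso.Structure M] [Lmso.Structure N] (g : N ↪[Lmso] M) (c : M)
    (hc : ∀ y, subE y c ↔ ∃ z, g z = y) {n : ℕ} (φ : BF n) (v : Empty → M) (w : Empty → N)
    (xs : Fin n → N) (ys : Fin (n + 2) → M) (hys : ∀ i, ys (i.addNat 2) = g (xs i))
    (i : Fin (n + 2)) (hi : ys i = c) :
    (relv (φ.liftAt 2 0) i).Realize v ys ↔ φ.Realize w xs := by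
  have ht {m : ℕ} (xs : Fin m → N) (ys : Fin (m + 2) → M) (hys : ∀ i, ys (i.addNat 2) = g (xs i))
      (t : Lmso.Term (Empty ⊕ Fin m)) :
      (t.liftAt 2 0).realize (Sum.elim v ys) = g (t.realize (Sum.elim w xs)) := by
    rw [Term.realize_liftAt, ← HomClass.realize_term]
    congr 1
    ext (e | j)
    · exact e.elim
    · simp [hys]
  induction φ with
  | falsum => rfl
  | equal t₁ t₂ =>
    simp only [BoundedFormula.liftAt, BoundedFormula.mapTermRel, relv, BoundedFormula.Realize]
    rw [ht xs ys hys, ht xs ys hys, g.injective.eq_iff]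
  | rel R ts =>
    simp only [BoundedFormula.liftAt, BoundedFormula.mapTermRel, relv, BoundedFormula.Realize]
    simp only [ht xs ys hys, id]
    exact g.map_rel R _
  | imp f₁ f₂ ih₁ ih₂ =>
    exact imp_congr (ih₁ xs ys hys i hi) (ih₂ xs ys hys i hi)
  | @all m f ih =>
    have e : ((f.all).liftAt 2 0 : BF (m + 2)) = (f.liftAt 2 0 : BF (m + 3)).all := by
      simp only [BoundedFormula.liftAt, BoundedFormula.mapTermRel]
      erw [BoundedFormula.castLE_rfl]
    rw [e]
    simp only [relv, BoundedFormula.realize_all, BoundedFormula.realize_imp, realize_sub',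
      Fin.snoc_last, Fin.snoc_castSucc, hi, hc]
    have key (z : N) := ih (Fin.snoc (α := fun _ => N) xs z) (Fin.snoc (α := fun _ => M) ys (g z))
      (Fin.lastCases (by
          rw [show (Fin.last m).addNat 2 = Fin.last (m + 2) from rfl, Fin.snoc_last, Fin.snoc_last])
        fun j => by
          rw [show (j.castSucc).addNat 2 = (j.addNat 2).castSucc from rfl, Fin.snoc_castSucc,
            Fin.snoc_castSucc, hys]) i.castSucc (by rw [Fin.snoc_castSucc, hi])
    constructor
    · exact fun h z => (key z).1 (h _ ⟨z, rfl⟩)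
    · rintro h _ ⟨z, rfl⟩
      exact (key z).2 (h z)

lemma realize_relv_sentence {M N : Type*} [Lmso.Structure M] [Lmso.Structure N] (g : N ↪[Lmso] M)
    (c : M) (hc : ∀ y, subE y c ↔ ∃ z, g z = y) (φ : Lmso.Sentence) (v : Empty → M)
    (ys : Fin 2 → M) (i : Fin 2) (hi : ys i = c) :
    (relv (BoundedFormula.liftAt 2 0 φ) i).Realize v ys ↔ N ⊨ φ :=
  (realize_relv g c hc φ v default Fin.elim0 ys (fun i => i.elim0) i hi).trans
    (realize_sentence_iff _ _ _).symm

/-! ### Semantics of the axioms -/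

section Axioms

variable {M : Type*} [Lmso.Structure M]

lemma realize_axRefl : M ⊨ axRefl ↔ ∀ a : M, subE a a := by
  simp [Sentence.Realize, Formula.Realize, axRefl, Fin.snoc]

lemma realize_axAntisymm : M ⊨ axAntisymm ↔ ∀ a b : M, subE a b → subE b a → a = b := by
  simp [Sentence.Realize, Formula.Realize, axAntisymm, Fin.snoc]

lemma realize_axTrans : M ⊨ axTrans ↔ ∀ a b c : M, subE a b → subE b c → subE a c := by
  simp [Sentence.Realize, Formula.Realize, axTrans, Fin.snoc]

lemma realize_axBotLe : M ⊨ axBotLe ↔ ∀ a : M, subE (botE M) a := by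
  simp [Sentence.Realize, Formula.Realize, axBotLe, Fin.snoc]

lemma realize_axTop : M ⊨ axTop ↔ ∃ a : M, ∀ b, subE b a := by
  simp [Sentence.Realize, Formula.Realize, axTop, Fin.snoc]

/-- `m` is a meet of `a` and `b`. -/
def IsMeetE (m a b : M) : Prop := (subE m a ∧ subE m b) ∧ ∀ c, subE c a → subE c b → subE c m

/-- `m` is a join of `a` and `b`. -/
def IsJoinE (m a b : M) : Prop := (subE a m ∧ subE b m) ∧ ∀ c, subE a c → subE b c → subE m c

/-- `b` is a complement of `a`. -/
def IsComplE (b a : M) : Prop :=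
  (∀ c, subE c b → subE c a → c = botE M) ∧ ∀ c, subE b c → subE a c → ∀ d, subE d c

section Formulas

variable {n : ℕ} (v : Empty → M) (xs : Fin n → M)

@[simp] lemma realize_isMeet (k i j : Fin n) :
    (isMeet k i j).Realize v xs ↔ IsMeetE (xs k) (xs i) (xs j) := by
  simp [isMeet, IsMeetE]

@[simp] lemma realize_isJoin (k i j : Fin n) :
    (isJoin k i j).Realize v xs ↔ IsJoinE (xs k) (xs i) (xs j) := by
  simp [isJoin, IsJoinE]

@[simp] lemma realize_isComplOf (j i : Fin n) :
    (isComplOf j i).Realize v xs ↔ IsComplE (xs j) (xs i) := by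
  have (c : M) : (Fin.snoc (α := fun _ => M) xs c (Fin.last n)) = c := Fin.snoc_last _ _
  simp [isComplOf, IsComplE, meetIsBot, joinIsTop]
  grind

@[simp] lemma realize_isAtomDef (i : Fin n) : (isAtomDef i).Realize v xs ↔
    xs i ≠ botE M ∧ ∀ c, subE c (xs i) → c = botE M ∨ c = xs i := by
  simp [isAtomDef]

@[simp] lemma realize_isLeastAtom (i : Fin n) : (isLeastAtom i).Realize v xs ↔
    atE (xs i) ∧ ∀ c, atE c → ¬exleE c (xs i) := by
  simp [isLeastAtom]

@[simp] lemma realize_isGreatestAtom (i : Fin n) : (isGreatestAtom i).Realize v xs ↔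
    atE (xs i) ∧ ∀ c, atE c → ¬exleE (xs i) c := by
  simp [isGreatestAtom]

@[simp] lemma realize_isSuccOf (j i : Fin n) : (isSuccOf j i).Realize v xs ↔
    ((atE (xs i) ∧ atE (xs j)) ∧ exleE (xs i) (xs j)) ∧
      ∀ c, atE c → exleE (xs i) c → c = xs j ∨ exleE (xs j) c := by
  simp [isSuccOf]

end Formulas

lemma realize_axMeet : M ⊨ axMeet ↔ ∀ a b : M, ∃ m, IsMeetE m a b := by
  simp [Sentence.Realize, Formula.Realize, axMeet, Fin.snoc]

lemma realize_axJoin : M ⊨ axJoin ↔ ∀ a b : M, ∃ m, IsJoinE m a b := by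
  simp [Sentence.Realize, Formula.Realize, axJoin, Fin.snoc]

lemma realize_axCompl : M ⊨ axCompl ↔ ∀ a : M, ∃ b, IsComplE b a := by
  simp [Sentence.Realize, Formula.Realize, axCompl, Fin.snoc]

lemma realize_axDistrib : M ⊨ axDistrib ↔ ∀ a b c ab ac bc l r : M, IsMeetE ab a b →
    IsMeetE ac a c → IsJoinE bc b c → IsMeetE l a bc → IsJoinE r ab ac → subE l r := by
  simp [Sentence.Realize, Formula.Realize, axDistrib, Fin.snoc]

lemma realize_axAt : M ⊨ axAt ↔
    ∀ a : M, atE a ↔ a ≠ botE M ∧ ∀ c, subE c a → c = botE M ∨ c = a := by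
  simp [Sentence.Realize, Formula.Realize, axAt, Fin.snoc]

lemma realize_axAtomic : M ⊨ axAtomic ↔ ∀ a : M, a ≠ botE M → ∃ x, atE x ∧ subE x a := by
  simp [Sentence.Realize, Formula.Realize, axAtomic, Fin.snoc]

lemma realize_axIrrefl : M ⊨ axIrrefl ↔ ∀ a : M, atE a → ¬exleE a a := by
  simp [Sentence.Realize, Formula.Realize, axIrrefl, Fin.snoc]

lemma realize_axTransAt : M ⊨ axTransAt ↔ ∀ a b c : M, atE a → atE b → atE c →
    exleE a b → exleE b c → exleE a c := by
  simp [Sentence.Realize, Formula.Realize, axTransAt, Fin.snoc]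

lemma realize_axTrich : M ⊨ axTrich ↔ ∀ a b : M, atE a → atE b →
    (exleE a b ∨ a = b) ∨ exleE b a := by
  simp [Sentence.Realize, Formula.Realize, axTrich, Fin.snoc]

lemma realize_axExleDef : M ⊨ axExleDef ↔ ∀ a b : M, exleE a b ↔
    ∃ x y, (((atE x ∧ atE y) ∧ subE x a) ∧ subE y b) ∧ exleE x y := by
  simp [Sentence.Realize, Formula.Realize, axExleDef, Fin.snoc]

lemma realize_axLeastAtom : M ⊨ axLeastAtom ↔
    ((∃ a : M, atE a) → ∃ a : M, atE a ∧ ∀ c, atE c → ¬exleE c a) := by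
  simp [Sentence.Realize, Formula.Realize, axLeastAtom, Fin.snoc]

lemma realize_axGreatestAtom : M ⊨ axGreatestAtom ↔
    ((∃ a : M, atE a) → ∃ a : M, atE a ∧ ∀ c, atE c → ¬exleE a c) := by
  simp [Sentence.Realize, Formula.Realize, axGreatestAtom, Fin.snoc]

lemma realize_axSucc : M ⊨ axSucc ↔ ∀ a : M, atE a → (∃ b, atE b ∧ exleE a b) →
    ∃ b, ((atE a ∧ atE b) ∧ exleE a b) ∧ ∀ c, atE c → exleE a c → c = b ∨ exleE b c := by
  simp [Sentence.Realize, Formula.Realize, axSucc, Fin.snoc]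

lemma realize_axPred : M ⊨ axPred ↔ ∀ a : M, atE a → (∃ b, atE b ∧ exleE b a) →
    ∃ b, ((atE b ∧ atE a) ∧ exleE b a) ∧ ∀ c, atE c → exleE b c → c = a ∨ exleE a c := by
  simp [Sentence.Realize, Formula.Realize, axPred, Fin.snoc]

lemma realize_axLeastIn : M ⊨ axLeastIn ↔ ∀ a : M, a ≠ botE M →
    ∃ x, (atE x ∧ subE x a) ∧ ∀ y, atE y → subE y a → ¬exleE y x := by
  simp [Sentence.Realize, Formula.Realize, axLeastIn, Fin.snoc]

lemma realize_compAx {n : ℕ} (η : BF (n + 1)) (v : Empty → M) :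
    M ⊨ compAx η ↔ ∀ ys : Fin n → M, ∃ X : M,
    ∀ x, atE x → (subE x X ↔ η.Realize v (Fin.snoc (α := fun _ => M) ys x)) := by
  rw [Sentence.Realize, compAx, BoundedFormula.realize_alls, Subsingleton.elim v default]
  simp only [BoundedFormula.realize_ex, BoundedFormula.realize_all, BoundedFormula.realize_imp,
    BoundedFormula.realize_iff, realize_at', realize_sub', Fin.snoc_last, Fin.snoc_castSucc]
  refine forall_congr' fun ys => exists_congr fun X => forall_congr' fun x => imp_congr_right
    fun _ => iff_congr Iff.rfl ?_
  rw [BoundedFormula.realize_liftAt (by omega)]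
  refine iff_of_eq (congrArg _ (funext (Fin.lastCases ?_ fun i => ?_)))
  · simp only [Function.comp_apply, Fin.val_last, lt_irrefl, if_false, Fin.snoc_last]
    exact Fin.snoc_last (α := fun _ => M) (n := n + 1) _ _
  · simp only [Function.comp_apply, Fin.val_castSucc, i.is_lt, if_true, Fin.snoc_castSucc]
    exact (Fin.snoc_castSucc (α := fun _ => M) (n := n + 1) _ _ i.castSucc).trans
      (Fin.snoc_castSucc (α := fun _ => M) _ _ i)

end Axioms

/-! ### The finite models -/

lemma msoN_models (n : ℕ) : MSOn n ⊨ TMSOFin := by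
  have meet (m a b : Set (Fin n)) : IsMeetE m a b ↔ m = a ∩ b := by
    simp only [IsMeetE, subE_set]
    constructor
    · rintro ⟨h1, h2⟩
      exact (Set.subset_inter h1.1 h1.2).antisymm
        (h2 _ Set.inter_subset_left Set.inter_subset_right)
    · rintro rfl
      exact ⟨⟨Set.inter_subset_left, Set.inter_subset_right⟩, fun c => Set.subset_inter⟩
  have join (m a b : Set (Fin n)) : IsJoinE m a b ↔ m = a ∪ b := by
    simp only [IsJoinE, subE_set]
    constructor
    · rintro ⟨h1, h2⟩
      exact (h2 _ Set.subset_union_left Set.subset_union_right).antisymm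
        (Set.union_subset h1.1 h1.2)
    · rintro rfl
      exact ⟨⟨Set.subset_union_left, Set.subset_union_right⟩, fun c => Set.union_subset⟩
  rw [TMSOFin, Tbase, Theory.model_union_iff, Theory.model_union_iff]
  refine ⟨⟨?_, ?_⟩, ?_⟩
  · simp only [Theory.model_iff, Set.mem_insert_iff, Set.mem_singleton_iff, forall_eq_or_imp,
      forall_eq, realize_axRefl, realize_axAntisymm, realize_axTrans, realize_axBotLe,
      realize_axTop, realize_axMeet, realize_axJoin, realize_axCompl, realize_axDistrib,
      realize_axAt, realize_axAtomic, realize_axIrrefl, realize_axTransAt, realize_axTrich,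
      realize_axExleDef, meet, join, exists_eq, implies_true, true_and, botE_set, subE_set]
    refine ⟨fun _ => Set.Subset.rfl, fun _ _ => Set.Subset.antisymm,
      fun _ _ _ => Set.Subset.trans, fun _ => Set.empty_subset _,
      ⟨Set.univ, Set.subset_univ⟩, ?_, ?_, ?_, ?_, ?_, ?_, ?_, ?_⟩
    · refine fun a => ⟨aᶜ, fun c h1 h2 => ?_, fun c h1 h2 d x _ => ?_⟩
      · exact Set.eq_empty_of_forall_notMem fun x hx => h1 hx (h2 hx)
      · exact (em (x ∈ a)).elim (@h2 x) (@h1 x)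
    · rintro a b c _ _ _ _ _ rfl rfl rfl rfl rfl
      exact (Set.inter_union_distrib_left _ _ _).subset
    · refine fun a => ⟨?_, fun ⟨h1, h2⟩ => ?_⟩
      · rintro ⟨x, rfl⟩
        exact ⟨Set.singleton_ne_empty x, fun c => Set.subset_singleton_iff_eq.1⟩
      · obtain ⟨x, hx⟩ := Set.nonempty_iff_ne_empty.2 h1
        refine ⟨x, ((h2 {x} (Set.singleton_subset_iff.2 hx)).resolve_left
          (Set.singleton_ne_empty x)).symm⟩
    · intro a ha
      obtain ⟨x, hx⟩ := Set.nonempty_iff_ne_empty.2 ha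
      exact ⟨{x}, ⟨x, rfl⟩, Set.singleton_subset_iff.2 hx⟩
    · rintro _ ⟨x, rfl⟩
      simp
    · rintro _ _ _ ⟨x, rfl⟩ ⟨y, rfl⟩ ⟨z, rfl⟩
      simpa using lt_trans
    · rintro _ _ ⟨x, rfl⟩ ⟨y, rfl⟩
      simpa [or_assoc] using lt_trichotomy x y
    · intro a b
      constructor
      · rintro ⟨x, hx, y, hy, hxy⟩
        exact ⟨{x}, {y}, ⟨⟨⟨⟨x, rfl⟩, ⟨y, rfl⟩⟩, Set.singleton_subset_iff.2 hx⟩,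
          Set.singleton_subset_iff.2 hy⟩, x, rfl, y, rfl, hxy⟩
      · rintro ⟨_, _, ⟨⟨⟨⟨x, rfl⟩, ⟨y, rfl⟩⟩, hx⟩, hy⟩, hxy⟩
        exact ⟨x, by simpa using hx, y, by simpa using hy, by simpa using hxy⟩
  · simp only [Theory.model_iff, Set.mem_iUnion, Set.mem_range]
    rintro _ ⟨m, η, rfl⟩
    rw [realize_compAx η default]
    refine fun ys => ⟨{x | η.Realize default (Fin.snoc (α := fun _ => Set (Fin n)) ys {x})}, ?_⟩
    rintro _ ⟨x, rfl⟩
    rw [subE_set, Set.singleton_subset_iff, Set.mem_ofPred_eq]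
  · simp only [Theory.model_iff, Set.mem_insert_iff, Set.mem_singleton_iff, forall_eq_or_imp,
      forall_eq, realize_axLeastAtom, realize_axGreatestAtom, realize_axSucc, realize_axPred,
      realize_axLeastIn]
    have lt (x y : Fin n) : exleE ({x} : Set (Fin n)) {y} ↔ x < y := by simp
    refine ⟨?_, ?_, ?_, ?_, ?_⟩
    · rintro ⟨_, a, rfl⟩
      have : Nonempty (Fin n) := ⟨a⟩
      obtain ⟨m, hm⟩ := Finite.exists_min (fun i : Fin n => i)
      refine ⟨{m}, ⟨m, rfl⟩, ?_⟩
      rintro _ ⟨c, rfl⟩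
      rw [lt]
      exact (hm c).not_gt
    · rintro ⟨_, a, rfl⟩
      have : Nonempty (Fin n) := ⟨a⟩
      obtain ⟨m, hm⟩ := Finite.exists_max (fun i : Fin n => i)
      refine ⟨{m}, ⟨m, rfl⟩, ?_⟩
      rintro _ ⟨c, rfl⟩
      rw [lt]
      exact (hm c).not_gt
    · rintro _ ⟨a, rfl⟩ ⟨_, ⟨b, rfl⟩, hab⟩
      rw [lt] at hab
      refine ⟨{⟨a + 1, by omega⟩}, ⟨⟨⟨_, rfl⟩, _, rfl⟩, ?_⟩, ?_⟩
      · rw [lt, Fin.lt_def]; simp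
      · rintro _ ⟨c, rfl⟩
        simp only [lt, Set.singleton_eq_singleton_iff, Fin.lt_def, Fin.ext_iff]
        omega
    · rintro _ ⟨a, rfl⟩ ⟨_, ⟨b, rfl⟩, hab⟩
      rw [lt] at hab
      refine ⟨{⟨a - 1, by omega⟩}, ⟨⟨⟨_, rfl⟩, _, rfl⟩, ?_⟩, ?_⟩
      · rw [lt, Fin.lt_def]
        have := Fin.lt_def.1 hab
        show a.val - 1 < a.val
        omega
      · rintro _ ⟨c, rfl⟩
        simp only [lt, Set.singleton_eq_singleton_iff, Fin.lt_def, Fin.ext_iff]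
        omega
    · intro a ha
      obtain ⟨x, hx, hmin⟩ := Set.exists_min_image a id a.toFinite
        (Set.nonempty_iff_ne_empty.2 ha)
      refine ⟨{x}, ⟨⟨x, rfl⟩, Set.singleton_subset_iff.2 hx⟩, ?_⟩
      rintro _ ⟨y, rfl⟩ hy
      rw [lt]
      exact (hmin y (Set.singleton_subset_iff.1 hy)).not_gt

/-! ### Models of `T_MSO(Fin)` are pseudofinite -/

/-- The semantic content of the axioms of `T_MSO(Fin)`. -/
class IsMSOFin (M : Type*) [Lmso.Structure M] : Prop where
  refl : ∀ a : M, subE a a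
  antisymm : ∀ a b : M, subE a b → subE b a → a = b
  trans : ∀ a b c : M, subE a b → subE b c → subE a c
  bot_le : ∀ a : M, subE (botE M) a
  top : ∃ a : M, ∀ b, subE b a
  meet : ∀ a b : M, ∃ m, IsMeetE m a b
  join : ∀ a b : M, ∃ m, IsJoinE m a b
  compl : ∀ a : M, ∃ b, IsComplE b a
  distrib : ∀ a b c ab ac bc l r : M, IsMeetE ab a b → IsMeetE ac a c → IsJoinE bc b c →
    IsMeetE l a bc → IsJoinE r ab ac → subE l r
  at_iff : ∀ a : M, atE a ↔ a ≠ botE M ∧ ∀ c, subE c a → c = botE M ∨ c = a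
  atomic : ∀ a : M, a ≠ botE M → ∃ x, atE x ∧ subE x a
  irrefl : ∀ a : M, atE a → ¬exleE a a
  trans_at : ∀ a b c : M, atE a → atE b → atE c → exleE a b → exleE b c → exleE a c
  trich : ∀ a b : M, atE a → atE b → (exleE a b ∨ a = b) ∨ exleE b a
  exle_iff : ∀ a b : M, exleE a b ↔
    ∃ x y, (((atE x ∧ atE y) ∧ subE x a) ∧ subE y b) ∧ exleE x y
  comprehension : ∀ {n : ℕ} (η : BF (n + 1)) (v : Empty → M) (ys : Fin n → M), ∃ X : M,
    ∀ x, atE x → (subE x X ↔ η.Realize v (Fin.snoc (α := fun _ => M) ys x))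
  greatest_atom : (∃ a : M, atE a) → ∃ a : M, atE a ∧ ∀ c, atE c → ¬exleE a c
  pred : ∀ a : M, atE a → (∃ b, atE b ∧ exleE b a) →
    ∃ b, ((atE b ∧ atE a) ∧ exleE b a) ∧ ∀ c, atE c → exleE b c → c = a ∨ exleE a c
  least_in : ∀ a : M, a ≠ botE M →
    ∃ x, (atE x ∧ subE x a) ∧ ∀ y, atE y → subE y a → ¬exleE y x

lemma isMSOFin_of_models {M : Type*} [Lmso.Structure M] (h : M ⊨ TMSOFin) : IsMSOFin M := by
  rw [TMSOFin, Tbase, Theory.model_union_iff, Theory.model_union_iff] at h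
  obtain ⟨⟨h1, h2⟩, h3⟩ := h
  simp only [Theory.model_iff, Set.mem_insert_iff, Set.mem_singleton_iff, forall_eq_or_imp,
    forall_eq, realize_axRefl, realize_axAntisymm, realize_axTrans, realize_axBotLe,
    realize_axTop, realize_axMeet, realize_axJoin, realize_axCompl, realize_axDistrib,
    realize_axAt, realize_axAtomic, realize_axIrrefl, realize_axTransAt, realize_axTrich,
    realize_axExleDef, realize_axLeastAtom, realize_axGreatestAtom, realize_axSucc,
    realize_axPred, realize_axLeastIn] at h1 h3
  obtain ⟨a1, a2, a3, a4, a5, a6, a7, a8, a9, a10, a11, a12, a13, a14, a15⟩ := h1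
  obtain ⟨b1, b2, b3, b4, b5⟩ := h3
  exact ⟨a1, a2, a3, a4, a5, a6, a7, a8, a9, a10, a11, a12, a13, a14, a15,
    fun {n} η v => (realize_compAx η v).1
      (h2.realize_of_mem _ (Set.mem_iUnion.2 ⟨n, η, rfl⟩)), b2, b4, b5⟩

/-- The atoms of a structure. -/
abbrev Atoms (M : Type*) [Lmso.Structure M] : Type _ := {x : M // atE x}

namespace IsMSOFin

section Model

variable {M : Type*} [Lmso.Structure M] [IsMSOFin M]

noncomputable instance : LinearOrder (Atoms M) where
  le x y := x = y ∨ exleE x.1 y.1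
  lt x y := exleE x.1 y.1
  le_refl x := Or.inl rfl
  le_trans x y z := by
    rintro (rfl | h1) (rfl | h2)
    · exact Or.inl rfl
    · exact Or.inr h2
    · exact Or.inr h1
    · exact Or.inr (trans_at _ _ _ x.2 y.2 z.2 h1 h2)
  lt_iff_le_not_ge x y := by
    constructor
    · refine fun h => ⟨Or.inr h, ?_⟩
      rintro (rfl | h')
      · exact irrefl _ y.2 h
      · exact irrefl _ x.2 (trans_at _ _ _ x.2 y.2 x.2 h h')
    · rintro ⟨rfl | h, h'⟩
      · exact absurd (Or.inl rfl) h'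
      · exact h
  le_antisymm x y := by
    rintro (rfl | h1) (h | h2)
    · rfl
    · rfl
    · exact h.symm
    · exact absurd (trans_at _ _ _ x.2 y.2 x.2 h1 h2) (irrefl _ x.2)
  le_total x y := by
    obtain (h | h) | h := trich x.1 y.1 x.2 y.2
    · exact Or.inl (Or.inr h)
    · exact Or.inl (Or.inl (Subtype.ext h))
    · exact Or.inr (Or.inr h)
  toDecidableLE := Classical.decRel _

lemma lt_iff (x y : Atoms M) : x < y ↔ exleE x.1 y.1 := Iff.rfl

lemma le_iff (x y : Atoms M) : x ≤ y ↔ x.1 = y.1 ∨ exleE x.1 y.1 :=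
  or_congr_left Subtype.ext_iff

lemma ne_bot (x : Atoms M) : x.1 ≠ botE M := ((at_iff _).1 x.2).1

lemma eq_bot_of_sub {a : M} (h : subE a (botE M)) : a = botE M := antisymm _ _ h (bot_le a)

lemma sub_iff_atoms (a b : M) : subE a b ↔ ∀ x : Atoms M, subE x.1 a → subE x.1 b := by
  refine ⟨fun h x hx => trans _ _ _ hx h, fun h => ?_⟩
  obtain ⟨b', hb', hb''⟩ := compl b
  obtain ⟨ab, hab⟩ := meet a b
  obtain ⟨m, hm⟩ := meet a b'
  obtain ⟨bc, hbc⟩ := join b b'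
  obtain ⟨l, hl⟩ := meet a bc
  obtain ⟨r, hr⟩ := join ab m
  have hmbot : m = botE M := by
    by_contra hne
    obtain ⟨x, hx, hxm⟩ := atomic m hne
    exact ne_bot ⟨x, hx⟩ (hb' x (trans _ _ _ hxm hm.1.2)
      (h ⟨x, hx⟩ (trans _ _ _ hxm hm.1.1)))
  have hlr := distrib a b b' ab m bc l r hab hm hbc hl hr
  have h1 : subE a l := hl.2 a (refl a) (hb'' bc hbc.1.2 hbc.1.1 a)
  have h2 : subE r b := hr.2 b hab.1.2 (hmbot ▸ bot_le b)
  exact trans _ _ _ h1 (trans _ _ _ hlr h2)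

variable (M) in
/-- The embedding of a model into the powerset of its set of atoms. -/
noncomputable def emb : M ↪[Lmso] Set (Atoms M) := by
  have hsub (a b : M) : {x : Atoms M | subE x.1 a} ⊆ {x | subE x.1 b} ↔ subE a b :=
    (sub_iff_atoms a b).symm
  have hinj : Function.Injective fun a : M => {x : Atoms M | subE x.1 a} := fun a b hab =>
    antisymm _ _ ((hsub a b).1 hab.subset) ((hsub b a).1 hab.superset)
  refine mkEmb (fun a => {x : Atoms M | subE x.1 a}) hinj ?_ hsub ?_ ?_
  · exact Set.eq_empty_of_forall_notMem fun x hx => ne_bot x (eq_bot_of_sub hx)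
  · intro a b
    rw [exle_iff a b, exleE_set]
    constructor
    · rintro ⟨x, hx, y, hy, hxy⟩
      exact ⟨x.1, y.1, ⟨⟨⟨x.2, y.2⟩, hx⟩, hy⟩, hxy⟩
    · rintro ⟨x, y, ⟨⟨⟨hx, hy⟩, hxa⟩, hyb⟩, hxy⟩
      exact ⟨⟨x, hx⟩, hxa, ⟨y, hy⟩, hyb, hxy⟩
  · have key (x : Atoms M) : {y : Atoms M | subE y.1 x.1} = {x} := by
      refine Set.eq_singleton_iff_unique_mem.2 ⟨refl _, fun y hy => Subtype.ext ?_⟩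
      exact (((at_iff _).1 x.2).2 _ hy).resolve_left (ne_bot y)
    refine fun a => ⟨?_, fun ha => ⟨⟨a, ha⟩, key ⟨a, ha⟩⟩⟩
    rintro ⟨x, hx⟩
    have : a = x.1 := hinj (hx.trans (key x).symm)
    exact this ▸ x.2

lemma mem_emb {x : Atoms M} {a : M} : x ∈ emb M a ↔ subE x.1 a := Iff.rfl

lemma exists_emb_eq {n : ℕ} (η : BF (n + 1)) (ys : Fin n → M) : ∃ X : M,
    emb M X = {x | η.Realize default (Fin.snoc (α := fun _ => M) ys x.1)} := by
  obtain ⟨X, hX⟩ := comprehension η default ys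
  exact ⟨X, Set.ext fun x => hX x.1 x.2⟩

lemma exists_emb_inter (a b : M) : ∃ c, emb M c = emb M a ∩ emb M b := by
  obtain ⟨c, hc⟩ := exists_emb_eq (sub' 2 0 ⊓ sub' 2 1) ![a, b]
  refine ⟨c, hc.trans (Set.ext fun x => ?_)⟩
  simp [mem_emb]

lemma exists_emb_union (a b : M) : ∃ c, emb M c = emb M a ∪ emb M b := by
  obtain ⟨c, hc⟩ := exists_emb_eq (sub' 2 0 ⊔ sub' 2 1) ![a, b]
  refine ⟨c, hc.trans (Set.ext fun x => ?_)⟩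
  simp [mem_emb]

lemma exists_emb_Iio (x : Atoms M) : ∃ c, emb M c = Set.Iio x := by
  obtain ⟨c, hc⟩ := exists_emb_eq (exle' 1 0) ![x.1]
  refine ⟨c, hc.trans (Set.ext fun y => ?_)⟩
  simp [lt_iff]

lemma emb_atom (x : Atoms M) : emb M x.1 = {x} :=
  Set.eq_singleton_iff_unique_mem.2 ⟨refl x.1, fun y hy => Subtype.ext
    ((((at_iff _).1 x.2).2 _ hy).resolve_left (ne_bot y))⟩

/-- The substructure of elements below `c`. -/
def seg (c : M) : Lmso.Substructure M where
  carrier := {y | subE y c}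
  fun_mem {n} f xs _ := by
    match n, f with
    | 0, f => exact (funMap_eq_botE f xs).symm ▸ bot_le c

/-- The embedding of `seg c` into the powerset of the set of atoms. -/
noncomputable def segEmb (c : M) : seg c ↪[Lmso] Set (Atoms M) := (emb M).comp (seg c).subtype

lemma segEmb_apply (c : M) (a : seg c) : segEmb c a = emb M a.1 := rfl

lemma mem_seg_iff {c y : M} : y ∈ seg c ↔ emb M y ⊆ emb M c := (emb_sub (emb M) y c).symm

lemma oneStep_seg {x : Atoms M} {c d : M} (hc : emb M c = Set.Iio x) (hd : emb M d = Set.Iic x) :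
    OneStep x (segEmb c) (segEmb d) where
  lt a y hy := (hc.subset (mem_seg_iff.1 a.2 hy) : y ∈ Set.Iio x)
  exists_left p := by
    obtain ⟨a, ha⟩ := exists_emb_inter p.1 c
    refine ⟨⟨a, mem_seg_iff.2 (ha.subset.trans Set.inter_subset_right)⟩, x ∈ emb M p.1, ?_⟩
    have hp : emb M p.1 ⊆ Set.Iic x := hd ▸ mem_seg_iff.1 p.2
    ext y
    rw [segEmb_apply, segEmb_apply, addPt, Set.mem_ofPred_eq, ha, hc, Set.mem_inter_iff,
      Set.mem_Iio]
    constructor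
    · intro hy
      exact (lt_or_eq_of_le (hp hy)).imp (⟨hy, ·⟩) fun e => ⟨e, e ▸ hy⟩
    · rintro (h | ⟨rfl, h⟩)
      · exact h.1
      · exact h
  exists_right a ε := by
    have ha : emb M a.1 ⊆ Set.Iio x := hc ▸ mem_seg_iff.1 a.2
    by_cases hε : ε
    · obtain ⟨p, hp⟩ := exists_emb_union a.1 x.1
      rw [emb_atom] at hp
      refine ⟨⟨p, mem_seg_iff.2 ?_⟩, ?_⟩
      · rw [hp, hd]
        exact Set.union_subset (ha.trans Set.Iio_subset_Iic_self) (by simp)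
      · rw [segEmb_apply, segEmb_apply, hp]
        ext y
        simp [addPt, hε, or_comm]
    · refine ⟨⟨a.1, mem_seg_iff.2 ?_⟩, ?_⟩
      · rw [hd]
        exact ha.trans Set.Iio_subset_Iic_self
      · rw [segEmb_apply, segEmb_apply]
        ext y
        simp [addPt, hε]

end Model

section Types

variable {M : Type} [Lmso.Structure M] [IsMSOFin M]

/-- The elements whose segment has the same type of rank `k` as a finite order. -/
def FinLike (k : ℕ) (c : M) : Prop := tp k (Fin.elim0 : Fin 0 → seg c) ∈ Set.range (finTp k)

lemma finLike_bot (k : ℕ) : FinLike k (botE M) := by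
  obtain ⟨χ, hχ⟩ := exists_sentence_tp_mem k (Set.range (finTp k))
  rw [FinLike, ← hχ, sentence_iff_of_range_eq (segEmb (botE M))
    (imageEmb (OrderEmbedding.ofIsEmpty : Fin 0 ↪o Atoms M)) _ χ, hχ (MSOn 0) Fin.elim0]
  · exact ⟨0, rfl⟩
  · ext A
    constructor
    · rintro ⟨a, rfl⟩
      refine ⟨∅, ?_⟩
      rw [segEmb_apply, eq_bot_of_sub a.2, emb_bot]
      simp
    · rintro ⟨B, rfl⟩
      refine ⟨⟨botE M, refl _⟩, ?_⟩
      rw [segEmb_apply, emb_bot]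
      simp [Set.eq_empty_of_isEmpty B]

lemma finLike_of_Iic (k : ℕ) (x : Atoms M) (d : M) (hd : emb M d = Set.Iic x) : FinLike k d := by
  obtain ⟨χ, hχ⟩ := exists_sentence_tp_mem k (Set.range (finTp k))
  obtain ⟨B, hB⟩ := exists_emb_eq (M := M)
    (∃' ((∀' (at' 2 ⟹ (sub' 2 1 ⇔ (eq' 2 0 ⊔ exle' 2 0)))) ⊓
      ∼(relv (BoundedFormula.liftAt 2 0 χ) (1 : Fin 2)))) Fin.elim0
  have hbad (x : Atoms M) : x ∈ emb M B ↔ ∃ d, emb M d = Set.Iic x ∧ ¬FinLike k d := by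
    rw [hB, Set.mem_ofPred_eq, BoundedFormula.realize_ex]
    refine exists_congr fun d => ?_
    rw [BoundedFormula.realize_inf, BoundedFormula.realize_not,
      realize_relv_sentence (seg d).subtype d _ χ _ _ _ rfl, hχ _ Fin.elim0]
    · refine and_congr ?_ Iff.rfl
      rw [Set.ext_iff, Subtype.forall]
      simp [Fin.snoc, mem_emb, le_iff]
    · intro y
      exact ⟨fun h => ⟨⟨y, h⟩, rfl⟩, fun ⟨z, hz⟩ => hz ▸ z.2⟩
  by_contra hcon
  have hBne : B ≠ botE M := by
    rintro rfl
    have := (hbad x).2 ⟨d, hd, hcon⟩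
    rw [emb_bot] at this
    exact this
  obtain ⟨y, ⟨hy, hyB⟩, hmin⟩ := least_in B hBne
  lift y to Atoms M using hy
  obtain ⟨d, hd, hdbad⟩ := (hbad y).1 hyB
  obtain ⟨c, hc⟩ := exists_emb_Iio y
  have hgood : FinLike k c := by
    by_cases hex : ∃ b : M, atE b ∧ exleE b y.1
    · obtain ⟨z, ⟨⟨hz, -⟩, hzy⟩, hsucc⟩ := pred y.1 y.2 hex
      lift z to Atoms M using hz
      by_contra hcbad
      refine hmin z z.2 ((hbad z).2 ⟨c, hc.trans (Set.ext fun w => ?_), hcbad⟩) hzy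
      constructor
      · intro hw
        by_contra hzw
        obtain h | h := hsucc w w.2 ((lt_iff _ _).1 (not_le.1 fun h => hzw (Set.mem_Iic.2 h)))
        · exact (Set.mem_Iio.1 hw).ne (Subtype.ext h)
        · exact (Set.mem_Iio.1 hw).asymm h
      · exact fun hw => lt_of_le_of_lt (Set.mem_Iic.1 hw) hzy
    · have : c = botE M := (emb M).injective (by
        rw [hc, emb_bot]
        exact Set.eq_empty_of_forall_notMem fun w hw => hex ⟨w, w.2, hw⟩)
      exact this ▸ finLike_bot k
  obtain ⟨m, hm⟩ := hgood
  exact hdbad ⟨m + 1, ((oneStep_seg hc hd).tp_eq_finTp_succ _ _ hm.symm).symm⟩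

variable (M) in
lemma exists_fin_iff (φ : Lmso.Sentence) : ∃ n, M ⊨ φ ↔ MSOn n ⊨ φ := by
  obtain ⟨t, ht⟩ := top (M := M)
  have htop : emb M t = Set.univ := Set.eq_univ_of_forall fun x => ht x.1
  have hgood : FinLike (qr φ) t := by
    by_cases hex : ∃ a : M, atE a
    · obtain ⟨x, hx, hmax⟩ := greatest_atom hex
      refine finLike_of_Iic _ ⟨x, hx⟩ t (htop.trans ?_)
      exact (Set.eq_univ_of_forall fun y : Atoms M =>
        Set.mem_Iic.2 (not_lt.1 (hmax y.1 y.2))).symm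
    · have : t = botE M := (emb M).injective (by
        rw [htop, emb_bot]
        exact Set.eq_empty_of_forall_notMem fun w _ => hex ⟨w, w.2⟩)
      exact this ▸ finLike_bot _
  obtain ⟨n, hn⟩ := hgood
  refine ⟨n, (sentence_iff_of_range_eq (emb M) (segEmb t) (Set.ext fun A => ?_) φ).trans
    (sentence_iff_of_tp_eq φ _ _ hn.symm)⟩
  exact ⟨fun ⟨a, ha⟩ => ⟨⟨a, ht a⟩, ha⟩, fun ⟨a, ha⟩ => ⟨a.1, ha⟩⟩

end Types

end IsMSOFin

lemma FSpec_eq_iff (φ ψ : Lmso.Sentence) : FSpec φ = FSpec ψ ↔ TMSOFin ⊨ᵇ (φ ⇔ ψ) := by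
  have hiff (M : Type) [Lmso.Structure M] :
      M ⊨ (φ ⇔ ψ : Lmso.Sentence) ↔ (M ⊨ φ ↔ M ⊨ ψ) := by
    simp [Sentence.Realize, Formula.Realize]
  rw [Theory.models_sentence_iff, Set.ext_iff]
  constructor
  · intro h M
    have := isMSOFin_of_models M.is_model
    obtain ⟨n, hn⟩ := IsMSOFin.exists_fin_iff M (φ ⇔ ψ)
    rw [hn, hiff]
    exact h n
  · intro h n
    have := msoN_models n
    have := h (Theory.ModelType.of TMSOFin (MSOn n))
    exact (hiff _).1 this

/-! ### Spectra of sums -/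

@[simp] lemma realize_dwcl' {M : Type*} [Lmso.Structure M] {n : ℕ} (v : Empty → M) (xs : Fin n → M)
    (i : Fin n) : (dwcl' i).Realize v xs ↔
      ∀ x y, atE x → atE y → subE x (xs i) → exleE y x → subE y (xs i) := by
  simp [dwcl']

lemma isComplE_set {α : Type*} [LinearOrder α] (A B : Set α) : IsComplE B A ↔ B = Aᶜ := by
  constructor
  · rintro ⟨h1, h2⟩
    refine Set.Subset.antisymm (fun x hx hxA => ?_) (fun x hx => ?_)
    · exact Set.singleton_ne_empty x
        (h1 {x} (Set.singleton_subset_iff.2 hx) (Set.singleton_subset_iff.2 hxA))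
    · have := h2 (A ∪ B) Set.subset_union_right Set.subset_union_left {x}
      exact ((Set.singleton_subset_iff.1 this).resolve_left hx)
  · rintro rfl
    refine ⟨fun c h1 h2 => ?_, fun c h1 h2 d x _ => ?_⟩
    · exact Set.eq_empty_of_forall_notMem fun x hx => h1 hx (h2 hx)
    · exact (em (x ∈ A)).elim (@h2 x) (@h1 x)

lemma exists_eq_range_castAdd {n : ℕ} (X : Set (Fin n)) (hX : IsLowerSet X) :
    ∃ (a b : ℕ) (h : a + b = n), X = Set.range fun i : Fin a => Fin.cast h (i.castAdd b) := by
  obtain ⟨a, ha, haX⟩ : ∃ a ≤ n, ∀ i : Fin n, i ∈ X ↔ i.val < a := by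
    by_cases h : X = Set.univ
    · exact ⟨n, le_rfl, by simp [h]⟩
    · obtain ⟨m, hm, hmin⟩ := Set.exists_min_image Xᶜ id (Set.toFinite _)
        (Set.nonempty_compl.2 h)
      refine ⟨m, m.2.le, fun i => ⟨fun hi => ?_, fun hi => ?_⟩⟩
      · by_contra hmi
        exact hm (hX (not_lt.1 hmi) hi)
      · by_contra hiX
        exact (hmin i hiX).not_gt hi
  refine ⟨a, n - a, by omega, Set.ext fun i => (haX i).trans ⟨fun hi => ⟨⟨i, hi⟩, rfl⟩, ?_⟩⟩
  rintro ⟨j, rfl⟩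
  exact j.2

lemma compl_range_castAdd (a b : ℕ) :
    (Set.range (Fin.castAdd b : Fin a → Fin (a + b)))ᶜ = Set.range (Fin.natAdd a) := by
  ext i
  refine Fin.addCases (fun j => ?_) (fun j => ?_) i
  · simp only [Set.mem_compl_iff, Set.mem_range_self, not_true_eq_false, Set.mem_range, false_iff,
      not_exists]
    intro k hk
    have := congrArg Fin.val hk
    simp only [Fin.val_natAdd, Fin.val_castAdd] at this
    omega
  · simp only [Set.mem_compl_iff, Set.mem_range_self, iff_true, Set.mem_range, not_exists]
    intro k hk
    have := congrArg Fin.val hk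
    simp only [Fin.val_natAdd, Fin.val_castAdd] at this
    omega

lemma subE_range_iff {α β : Type*} [LinearOrder α] [LinearOrder β] (f : α ↪o β) (A : Set β) :
    subE A (Set.range f) ↔ ∃ B, imageEmb f B = A :=
  Set.subset_range_iff_exists_image_eq

lemma FSpec_plusSent (φ ψ : Lmso.Sentence) :
    FSpec (plusSent φ ψ) = {n : ℕ | ∃ a ∈ FSpec φ, ∃ b ∈ FSpec ψ, n = a + b} := by
  have key (a b : ℕ) (ys : Fin 2 → Set (Fin (a + b))) (v : Empty → Set (Fin (a + b)))
      (h0 : ys 0 = Set.range (Fin.castAdd b)) (h1 : ys 1 = (ys 0)ᶜ) :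
      ((relv (BoundedFormula.liftAt 2 0 φ) (0 : Fin 2)).Realize v ys ↔ MSOn a ⊨ φ) ∧
      ((relv (BoundedFormula.liftAt 2 0 ψ) (1 : Fin 2)).Realize v ys ↔ MSOn b ⊨ ψ) :=
    ⟨realize_relv_sentence (imageEmb (Fin.castAddOrderEmb b)) _
      (subE_range_iff (Fin.castAddOrderEmb b)) φ v ys 0 h0,
    realize_relv_sentence (imageEmb (Fin.natAddOrderEmb a)) _
      (subE_range_iff (Fin.natAddOrderEmb a)) ψ v ys 1
      (by rw [h1, h0, compl_range_castAdd]; rfl)⟩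
  ext n
  simp only [FSpec, plusSent, Set.mem_ofPred_eq, Sentence.Realize, Formula.Realize,
    BoundedFormula.realize_ex, BoundedFormula.realize_inf, realize_dwcl', realize_isComplOf,
    isComplE_set]
  constructor
  · rintro ⟨X, Y, ⟨⟨hX, hY⟩, h1⟩, h2⟩
    have hlow : IsLowerSet X := fun i j hij hi => by
      obtain rfl | hlt := eq_or_lt_of_le hij
      · exact hi
      · exact Set.singleton_subset_iff.1 (hX {i} {j} ⟨i, rfl⟩ ⟨j, rfl⟩
          (Set.singleton_subset_iff.2 hi) ⟨j, rfl, i, rfl, hlt⟩)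
    obtain ⟨a, b, rfl, hXa⟩ := exists_eq_range_castAdd X hlow
    obtain ⟨k1, k2⟩ := key a b _ _ hXa hY
    exact ⟨a, k1.1 h1, b, k2.1 h2, rfl⟩
  · rintro ⟨a, ha, b, hb, rfl⟩
    refine ⟨Set.range (Fin.castAdd b), (Set.range (Fin.castAdd b))ᶜ, ?_⟩
    refine ⟨⟨⟨?_, rfl⟩, (key a b _ _ rfl rfl).1.2 ha⟩, (key a b _ _ rfl rfl).2.2 hb⟩
    rintro _ _ ⟨x, rfl⟩ ⟨y, rfl⟩ hx ⟨_, hy, _, hx', hxy⟩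
    rw [Set.mem_singleton_iff.1 hy, Set.mem_singleton_iff.1 hx'] at hxy
    obtain ⟨j, rfl⟩ := Set.singleton_subset_iff.1 hx
    exact Set.singleton_subset_iff.2 ⟨⟨y, lt_trans hxy j.2⟩, rfl⟩

/-! ### Every ultimately periodic set is a spectrum -/

lemma mem_FSpec {φ : Lmso.Sentence} {n : ℕ} : n ∈ FSpec φ ↔ MSOn n ⊨ φ := Iff.rfl

lemma FSpec_sup (φ ψ : Lmso.Sentence) : FSpec (φ ⊔ ψ) = FSpec φ ∪ FSpec ψ := by
  ext n
  simp [mem_FSpec, Sentence.Realize, Formula.Realize]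

lemma FSpec_inf (φ ψ : Lmso.Sentence) : FSpec (φ ⊓ ψ) = FSpec φ ∩ FSpec ψ := by
  ext n
  simp [mem_FSpec, Sentence.Realize, Formula.Realize]

lemma FSpec_not (φ : Lmso.Sentence) : FSpec (∼φ) = (FSpec φ)ᶜ := by
  ext n
  simp [mem_FSpec, Sentence.Realize, Formula.Realize]

/-- A set of naturals is a spectrum if it is the set of sizes of finite models of a sentence. -/
def IsSpectrum (S : Set ℕ) : Prop := ∃ φ : Lmso.Sentence, FSpec φ = S

namespace IsSpectrum

lemma union {S T : Set ℕ} : IsSpectrum S → IsSpectrum T → IsSpectrum (S ∪ T)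
  | ⟨φ, hφ⟩, ⟨ψ, hψ⟩ => ⟨φ ⊔ ψ, by rw [FSpec_sup, hφ, hψ]⟩

lemma inter {S T : Set ℕ} : IsSpectrum S → IsSpectrum T → IsSpectrum (S ∩ T)
  | ⟨φ, hφ⟩, ⟨ψ, hψ⟩ => ⟨φ ⊓ ψ, by rw [FSpec_inf, hφ, hψ]⟩

lemma compl {S : Set ℕ} : IsSpectrum S → IsSpectrum Sᶜ
  | ⟨φ, hφ⟩ => ⟨∼φ, by rw [FSpec_not, hφ]⟩

lemma add {S T : Set ℕ} : IsSpectrum S → IsSpectrum T →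
    IsSpectrum {n | ∃ a ∈ S, ∃ b ∈ T, n = a + b}
  | ⟨φ, hφ⟩, ⟨ψ, hψ⟩ => ⟨plusSent φ ψ, by rw [FSpec_plusSent, hφ, hψ]⟩

lemma empty : IsSpectrum ∅ := ⟨⊥, Set.eq_empty_of_forall_notMem fun _ h => h⟩

lemma biUnion {s : Set ℕ} (hs : s.Finite) (f : ℕ → Set ℕ) (hf : ∀ m, IsSpectrum (f m)) :
    IsSpectrum (⋃ m ∈ s, f m) := by
  induction s, hs using Set.Finite.induction_on with
  | empty => simpa using empty
  | insert _ _ ih => rw [Set.biUnion_insert]; exact (hf _).union ih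

lemma zero : IsSpectrum {0} := by
  refine ⟨∼(∃' at' 0), Set.ext fun n => ?_⟩
  simp only [mem_FSpec, Sentence.Realize, Formula.Realize, BoundedFormula.realize_not,
    BoundedFormula.realize_ex, realize_at', Set.mem_singleton_iff, not_exists, atE_set]
  constructor
  · intro h
    by_contra hn
    exact h _ ⟨0, Nat.pos_of_ne_zero hn⟩ rfl
  · rintro rfl A i
    exact i.elim0

lemma one : IsSpectrum {1} := by
  have h := zero.compl.inter (zero.compl.add zero.compl).compl
  convert h using 1
  ext n
  simp only [Set.mem_singleton_iff, Set.mem_inter_iff, Set.mem_compl_iff, Set.mem_ofPred_eq,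
    not_exists, not_and]
  refine ⟨?_, fun ⟨h1, h2⟩ => ?_⟩
  · rintro rfl
    exact ⟨one_ne_zero, fun a ha b hb => by omega⟩
  · have := h2 1 one_ne_zero (n - 1)
    omega

lemma singleton (n : ℕ) : IsSpectrum {n} := by
  induction n with
  | zero => exact zero
  | succ n ih =>
    convert ih.add one using 1
    ext m
    simp

end IsSpectrum

/-- The sentence saying that the number of atoms is divisible by `d + 1`: the atoms can be
coloured cyclically by `d + 1` colours starting with the first colour and ending with the last. -/
noncomputable def dvdSent (d : ℕ) : Lmso.Sentence :=
  BoundedFormula.exs (n := d + 1) (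
    (∀' (isLeastAtom (Fin.last (d + 1)) ⟹ sub' (Fin.last (d + 1)) (Fin.castSucc 0))) ⊓
    (BoundedFormula.iInf fun j : Fin (d + 1) =>
      ∀' ∀' ((sub' (Fin.last (d + 1)).castSucc j.castSucc.castSucc ⊓
          isSuccOf (Fin.last (d + 2)) (Fin.last (d + 1)).castSucc) ⟹
        sub' (Fin.last (d + 2)) (j + 1).castSucc.castSucc)) ⊓
    (BoundedFormula.iInf fun j : Fin (d + 1) => BoundedFormula.iInf fun i : Fin (d + 1) =>
      ∀' ((at' (Fin.last (d + 1)) ⊓ sub' (Fin.last (d + 1)) i.castSucc ⊓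
          sub' (Fin.last (d + 1)) j.castSucc) ⟹ if i = j then ⊤ else ⊥)) ⊓
    (∀' (isGreatestAtom (Fin.last (d + 1)) ⟹
      sub' (Fin.last (d + 1)) (Fin.castSucc (-1)))))

lemma realize_dvdSent {M : Type*} [Lmso.Structure M] (d : ℕ) : M ⊨ dvdSent d ↔
    ∃ A : Fin (d + 1) → M, (((∀ x, (atE x ∧ ∀ c, atE c → ¬exleE c x) → subE x (A 0)) ∧
      ∀ j x y, (subE x (A j) ∧ ((atE x ∧ atE y) ∧ exleE x y) ∧
        ∀ c, atE c → exleE x c → c = y ∨ exleE y c) → subE y (A (j + 1))) ∧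
      ∀ j i x, (atE x ∧ subE x (A i)) ∧ subE x (A j) → i = j) ∧
      ∀ x, (atE x ∧ ∀ c, atE c → ¬exleE x c) → subE x (A (-1)) := by
  have hite (i j : Fin (d + 1)) (v : Empty → M) (xs : Fin (d + 2) → M) :
      BoundedFormula.Realize (if i = j then ⊤ else ⊥ : BF (d + 2)) v xs ↔ i = j := by
    split_ifs with h <;> simp [h]
  rw [Sentence.Realize, dvdSent, BoundedFormula.realize_exs]
  simp only [BoundedFormula.realize_inf, BoundedFormula.realize_all, BoundedFormula.realize_imp,
    BoundedFormula.realize_iInf, realize_isLeastAtom, realize_isGreatestAtom, realize_isSuccOf,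
    realize_sub', realize_at', Fin.snoc_last, Fin.snoc_castSucc, hite]

lemma ofNat_succ (d n : ℕ) : Fin.ofNat (d + 1) (n + 1) = Fin.ofNat (d + 1) n + 1 :=
  Fin.ext (by simp [Fin.val_add])

lemma ofNat_eq_zero_iff (d n : ℕ) : Fin.ofNat (d + 1) n = 0 ↔ d + 1 ∣ n := by
  rw [Fin.ext_iff, Nat.dvd_iff_mod_eq_zero]
  rfl

lemma FSpec_dvdSent (d : ℕ) : FSpec (dvdSent d) = {n | d + 1 ∣ n} := by
  ext n
  rw [mem_FSpec, realize_dvdSent, Set.mem_ofPred_eq, ← ofNat_eq_zero_iff]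
  have lt (x y : Fin n) : exleE ({x} : Set (Fin n)) {y} ↔ x < y := by simp
  constructor
  · rintro ⟨A, ⟨⟨h0, hsucc⟩, hdisj⟩, hlast⟩
    have key (i : ℕ) (hi : i < n) : subE ({⟨i, hi⟩} : Set (Fin n)) (A (Fin.ofNat (d + 1) i)) := by
      induction i with
      | zero =>
        refine h0 _ ⟨⟨_, rfl⟩, ?_⟩
        rintro _ ⟨c, rfl⟩
        rw [lt]
        exact Nat.not_lt_zero _
      | succ i ih =>
        rw [ofNat_succ]
        refine hsucc _ _ _ ⟨ih (by omega), ⟨⟨⟨_, rfl⟩, ⟨_, rfl⟩⟩, (lt _ _).2 i.lt_succ_self⟩, ?_⟩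
        rintro _ ⟨c, rfl⟩
        simp only [lt, Set.singleton_eq_singleton_iff, Fin.lt_def, Fin.ext_iff]
        omega
    obtain _ | n := n
    · rfl
    have := hdisj _ _ _ ⟨⟨⟨_, rfl⟩, key n n.lt_succ_self⟩, hlast _ ⟨⟨_, rfl⟩, by
      rintro _ ⟨c, rfl⟩
      rw [lt]
      exact (Fin.le_last c).not_gt⟩⟩
    rw [ofNat_succ, this, neg_add_cancel]
  · intro hn
    refine ⟨fun j => {i | Fin.ofNat (d + 1) i = j}, ⟨⟨?_, ?_⟩, ?_⟩, ?_⟩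
    · rintro _ ⟨⟨i, rfl⟩, hmin⟩
      have := i.pos
      have hi : i.val = 0 := by
        by_contra hi
        exact hmin {⟨0, this⟩} ⟨_, rfl⟩ ((lt _ _).2 (Nat.pos_of_ne_zero hi))
      rw [subE_set, Set.singleton_subset_iff, Set.mem_ofPred_eq, hi]
      rfl
    · rintro j _ _ ⟨hj, ⟨⟨⟨x, rfl⟩, ⟨y, rfl⟩⟩, hxy⟩, hc⟩
      rw [subE_set, Set.singleton_subset_iff, Set.mem_ofPred_eq] at hj ⊢
      rw [lt, Fin.lt_def] at hxy
      have := hc {⟨x + 1, by omega⟩} ⟨_, rfl⟩ ((lt _ _).2 (Nat.lt_succ_self _))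
      simp only [lt, Set.singleton_eq_singleton_iff, Fin.lt_def, Fin.ext_iff] at this
      rw [← hj, show y.val = x + 1 by omega, ofNat_succ]
    · rintro j i _ ⟨⟨⟨x, rfl⟩, hi⟩, hj⟩
      rw [subE_set, Set.singleton_subset_iff, Set.mem_ofPred_eq] at hi hj
      exact hi.symm.trans hj
    · rintro _ ⟨⟨i, rfl⟩, hmax⟩
      rw [subE_set, Set.singleton_subset_iff, Set.mem_ofPred_eq, eq_neg_iff_add_eq_zero,
        ← ofNat_succ, ← hn]
      congr 1
      by_contra hi
      exact hmax {⟨i + 1, by omega⟩} ⟨_, rfl⟩ ((lt _ _).2 (Nat.lt_succ_self _))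

lemma UltPeriodic.isSpectrum {S : Set ℕ} (hS : UltPeriodic S) : IsSpectrum S := by
  obtain ⟨N, d, hd, hper⟩ := hS
  obtain ⟨d, rfl⟩ := Nat.exists_eq_add_one.2 hd
  have hmul (m k : ℕ) (hm : N < m) : m ∈ S ↔ m + (d + 1) * k ∈ S := by
    induction k with
    | zero => rfl
    | succ k ih => rw [ih, hper _ (by omega), Nat.mul_succ, add_assoc]
  have h := (IsSpectrum.biUnion ((Set.finite_Iic N).inter_of_right S) _
    IsSpectrum.singleton).union (IsSpectrum.biUnion
      ((Set.finite_Ioc N (N + (d + 1))).inter_of_right S) _ fun m => (IsSpectrum.singleton m).add ⟨_, FSpec_dvdSent d⟩)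
  convert h using 1
  ext n
  simp only [Set.mem_union, Set.mem_iUnion, Set.mem_inter_iff, Set.mem_Iic, Set.mem_Ioc,
    Set.mem_singleton_iff, Set.mem_ofPred_eq, exists_prop]
  constructor
  · intro hn
    obtain hle | hlt := le_or_gt n N
    · exact Or.inl ⟨n, ⟨hn, hle⟩, rfl⟩
    · have e : N + 1 + (n - N - 1) % (d + 1) + (d + 1) * ((n - N - 1) / (d + 1)) = n := by
        have := Nat.mod_add_div (n - N - 1) (d + 1)
        omega
      have := Nat.mod_lt (n - N - 1) hd
      refine Or.inr ⟨N + 1 + (n - N - 1) % (d + 1), ⟨?_, by omega, by omega⟩, _, rfl,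
        (d + 1) * ((n - N - 1) / (d + 1)), dvd_mul_right _ _, e.symm⟩
      rw [hmul _ ((n - N - 1) / (d + 1)) (by omega), e]
      exact hn
  · rintro (⟨m, ⟨hm, -⟩, rfl⟩ | ⟨m, ⟨hm, h1, -⟩, _, rfl, _, ⟨k, rfl⟩, rfl⟩)
    · exact hm
    · exact (hmul _ k h1).1 hm

theorem statement18 :
    (∀ φ : Lmso.Sentence, UltPeriodic (FSpec φ)) ∧
    (∀ φ ψ : Lmso.Sentence, FSpec φ = FSpec ψ ↔ TMSOFin ⊨ᵇ (φ ⇔ ψ)) ∧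
    (∀ S : Set ℕ, UltPeriodic S → ∃ φ : Lmso.Sentence, FSpec φ = S) ∧
    (∀ φ ψ : Lmso.Sentence, FSpec (φ ⊔ ψ) = FSpec φ ∪ FSpec ψ) ∧
    (∀ φ ψ : Lmso.Sentence, FSpec (φ ⊓ ψ) = FSpec φ ∩ FSpec ψ) ∧
    (∀ φ : Lmso.Sentence, FSpec (∼φ) = (FSpec φ)ᶜ) ∧
    (∀ φ ψ : Lmso.Sentence,
      FSpec (plusSent φ ψ) = {n : ℕ | ∃ a ∈ FSpec φ, ∃ b ∈ FSpec ψ, n = a + b}) := by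
  exact ⟨ultPeriodic_FSpec, FSpec_eq_iff, fun _ hS => hS.isSpectrum, FSpec_sup, FSpec_inf,
    FSpec_not, FSpec_plusSent⟩

end MSO
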